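/- Let S h be defined on the Fourier side by (S h)^(ξ,τ) = ĥ(ξ,τ)/(τ − ξ³ + i). Then ‖S h‖_{L⁸(ℝ²)} ≤ c ‖h‖_{L^{8/7}(ℝ²)} for all Schwartz h, with an analogous bound for the multiplier 1/(τ − ξ³ − i). -/

import Mathlib

open MeasureTheory

/-- Space-time Fourier transform `ĥ(ξ,τ) = ∫∫ e^{-i(xξ+tτ)} h(x,t) dx dt`. -/
noncomputable def FT2 (h : ℝ × ℝ → ℂ) (ξ τ : ℝ) : ℂ :=
  ∫ p : ℝ × ℝ, Complex.exp (-(Complex.I * ((p.1 * ξ + p.2 * τ : ℝ) : ℂ))) * h p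

/-- The operator with Fourier multiplier `1/(τ - ξ³ + σ i)` (σ = ±1). -/
noncomputable def Sop (σ : ℝ) (h : ℝ × ℝ → ℂ) (p : ℝ × ℝ) : ℂ :=
  ∫ ξ : ℝ, ∫ τ : ℝ,
    Complex.exp (Complex.I * ((p.1 * ξ + p.2 * τ : ℝ) : ℂ)) *
      (FT2 h ξ τ / ((τ : ℂ) - (ξ : ℂ) ^ 3 + (σ : ℂ) * Complex.I))

section

open Set
open scoped ENNReal

theorem pow_eight_le_lintegral_of_ne_top {g : ℝ≥0∞} (hg : g ≠ ∞) :
    g ^ 8 ≤ ∫⁻ l in Ioi (0 : ℝ),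
      (if ENNReal.ofReal l < g then ENNReal.ofReal (8 * l ^ 7) else 0) := by
  lift g to NNReal using hg
  have h1 : ∫ l in (0 : ℝ)..g, 8 * l ^ 7 = (g : ℝ) ^ 8 := by
    rw [intervalIntegral.integral_const_mul, integral_pow]; ring
  calc (g : ℝ≥0∞) ^ 8 = ENNReal.ofReal ((g : ℝ) ^ 8) := by
        rw [ENNReal.ofReal_pow g.coe_nonneg]; simp
    _ = ∫⁻ l in Ioo (0 : ℝ) g, ENNReal.ofReal (8 * l ^ 7) := by
        rw [← h1, intervalIntegral.integral_of_le g.coe_nonneg, integral_Ioc_eq_integral_Ioo,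
          ofReal_integral_eq_lintegral_ofReal]
        · exact (Continuous.integrableOn_Icc (by fun_prop)).mono_set Ioo_subset_Icc_self
        · filter_upwards [ae_restrict_mem measurableSet_Ioo] with l hl
          have := hl.1
          positivity
    _ ≤ ∫⁻ l in Ioo (0 : ℝ) g,
          (if ENNReal.ofReal l < g then ENNReal.ofReal (8 * l ^ 7) else 0) := by
        refine setLIntegral_mono' measurableSet_Ioo fun l hl => ?_
        rw [if_pos]
        rw [← ENNReal.ofReal_coe_nnreal]
        exact (ENNReal.ofReal_lt_ofReal_iff (hl.1.trans hl.2)).2 hl.2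
    _ ≤ _ := lintegral_mono_set Ioo_subset_Ioi_self

theorem pow_eight_le_lintegral (g : ℝ≥0∞) :
    g ^ 8 ≤ ∫⁻ l in Ioi (0 : ℝ),
      (if ENNReal.ofReal l < g then ENNReal.ofReal (8 * l ^ 7) else 0) := by
  rcases eq_or_ne g ∞ with rfl | hg
  · have h : ∀ n : ℕ, (n : ℝ≥0∞) ≤ ∫⁻ l in Ioi (0 : ℝ),
        (if ENNReal.ofReal l < ∞ then ENNReal.ofReal (8 * l ^ 7) else 0) := by
      intro n
      calc (n : ℝ≥0∞) ≤ (n : ℝ≥0∞) ^ 8 := by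
            exact_mod_cast Nat.le_self_pow (by norm_num) n
        _ ≤ _ := pow_eight_le_lintegral_of_ne_top (ENNReal.natCast_ne_top n)
        _ ≤ _ := by
            refine lintegral_mono fun l => ?_
            dsimp only
            rw [if_pos ENNReal.ofReal_lt_top]
            split_ifs <;> simp
    refine le_top.trans_eq (ENNReal.eq_top_of_forall_nnreal_le fun r => ?_).symm
    obtain ⟨n, hn⟩ := exists_nat_ge r
    exact le_trans (by exact_mod_cast hn) (h n)
  · exact pow_eight_le_lintegral_of_ne_top hg

theorem lintegral_pow_eight_le {α : Type*} [MeasurableSpace α] {μ : Measure α} [SFinite μ]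
    {g : α → ℝ≥0∞} (hg : Measurable g) :
    ∫⁻ x, g x ^ 8 ∂μ ≤
      ∫⁻ l in Ioi (0 : ℝ), ENNReal.ofReal (8 * l ^ 7) * μ {x | ENNReal.ofReal l < g x} := by
  calc ∫⁻ x, g x ^ 8 ∂μ ≤ ∫⁻ x, (∫⁻ l in Ioi (0 : ℝ),
        (if ENNReal.ofReal l < g x then ENNReal.ofReal (8 * l ^ 7) else 0)) ∂μ :=
        lintegral_mono fun x => pow_eight_le_lintegral _
    _ = ∫⁻ l in Ioi (0 : ℝ), ∫⁻ x,
        (if ENNReal.ofReal l < g x then ENNReal.ofReal (8 * l ^ 7) else 0) ∂μ := by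
        rw [lintegral_lintegral_swap]
        refine Measurable.aemeasurable (Measurable.ite
          (p := fun z : α × ℝ => ENNReal.ofReal z.2 < g z.1) ?_ (by fun_prop) (by fun_prop))
        exact measurableSet_lt (by fun_prop) (by fun_prop)
    _ = _ := by
        refine lintegral_congr fun l => ?_
        rw [← lintegral_indicator_const (measurableSet_lt measurable_const hg)]
        refine lintegral_congr fun x => ?_
        simp [indicator]

theorem lintegral_comp_abs_le {φ : ℝ → ℝ≥0∞} (hφ : Measurable φ) :
    ∫⁻ y : ℝ, φ |y| ≤ 2 * ∫⁻ y in Ioi (0 : ℝ), φ y := by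
  have h1 : ∫⁻ y in Ioi (0 : ℝ), φ |y| = ∫⁻ y in Ioi (0 : ℝ), φ y :=
    setLIntegral_congr_fun measurableSet_Ioi fun y hy => by
      simp only [abs_of_pos (mem_Ioi.1 hy)]
  have h2 : ∫⁻ y in Iio (0 : ℝ), φ |y| = ∫⁻ y in Ioi (0 : ℝ), φ |y| := by
    have := (Measure.measurePreserving_neg (volume : Measure ℝ)).setLIntegral_comp_preimage
      (measurableSet_Ioi (a := (0 : ℝ))) (f := fun y => φ |y|) (by fun_prop)
    rw [← this]
    simp
  rw [← setLIntegral_univ, ← Iic_union_Ioi (a := (0 : ℝ))]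
  refine (lintegral_union_le _ _ _).trans ?_
  rw [setLIntegral_congr Iio_ae_eq_Iic.symm, h2, h1, two_mul]

theorem lintegral_near_kernel {R : ℝ} (hR : 0 < R) (t : ℝ) :
    ∫⁻ u : ℝ, (if |u - t| ≤ R then ENNReal.ofReal (|u - t| ^ (-(1/4) : ℝ)) else 0) ≤
      ENNReal.ofReal (8 / 3 * R ^ (3/4 : ℝ)) := by
  have hm : Measurable fun y : ℝ => if y ≤ R then ENNReal.ofReal (y ^ (-(1/4) : ℝ)) else 0 :=
    Measurable.ite measurableSet_Iic (by fun_prop) (by fun_prop)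
  rw [lintegral_sub_right_eq_self
    (fun y : ℝ => if |y| ≤ R then ENNReal.ofReal (|y| ^ (-(1/4) : ℝ)) else 0) t]
  refine (lintegral_comp_abs_le hm).trans ?_
  have h1 : ∫⁻ y in Ioi (0 : ℝ), (if y ≤ R then ENNReal.ofReal (y ^ (-(1/4) : ℝ)) else 0) =
      ∫⁻ y in Ioc (0 : ℝ) R, ENNReal.ofReal (y ^ (-(1/4) : ℝ)) := by
    rw [← lintegral_indicator measurableSet_Ioi, ← lintegral_indicator measurableSet_Ioc]
    refine lintegral_congr fun y => ?_
    simp only [indicator, mem_Ioi, mem_Ioc]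
    split_ifs <;> tauto
  have hi : IntervalIntegrable (fun y : ℝ => y ^ (-(1/4) : ℝ)) volume 0 R :=
    intervalIntegral.intervalIntegrable_rpow' (by norm_num)
  rw [h1, ← ofReal_integral_eq_lintegral_ofReal
    ((intervalIntegrable_iff_integrableOn_Ioc_of_le hR.le).1 hi), ← intervalIntegral.integral_of_le hR.le,
    integral_rpow (Or.inl (by norm_num))]
  · rw [Real.zero_rpow (by norm_num), ← ENNReal.ofReal_ofNat 2, ← ENNReal.ofReal_mul (by norm_num)]
    apply ENNReal.ofReal_le_ofReal
    norm_num
    linarith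
  · filter_upwards [ae_restrict_mem measurableSet_Ioc] with y hy
    have := hy.1
    positivity

theorem lintegral_far_kernel {R : ℝ} (hR : 0 < R) (t : ℝ) :
    ∫⁻ u : ℝ, (if |u - t| ≤ R then 0 else ENNReal.ofReal (|u - t| ^ (-(1/4) : ℝ))) ^ (8 : ℝ) ≤
      ENNReal.ofReal (2 / R) := by
  have hm : Measurable fun y : ℝ =>
      (if y ≤ R then 0 else ENNReal.ofReal (y ^ (-(1/4) : ℝ))) ^ (8 : ℝ) :=
    Measurable.pow_const (Measurable.ite measurableSet_Iic (by fun_prop) (by fun_prop)) _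
  rw [lintegral_sub_right_eq_self
    (fun y : ℝ => (if |y| ≤ R then 0 else ENNReal.ofReal (|y| ^ (-(1/4) : ℝ))) ^ (8 : ℝ)) t]
  refine (lintegral_comp_abs_le hm).trans ?_
  have h1 : ∫⁻ y in Ioi (0 : ℝ), (if y ≤ R then 0 else ENNReal.ofReal (y ^ (-(1/4) : ℝ))) ^ (8 : ℝ) =
      ∫⁻ y in Ioi R, ENNReal.ofReal (y ^ (-2 : ℝ)) := by
    rw [← lintegral_indicator measurableSet_Ioi, ← lintegral_indicator measurableSet_Ioi]
    refine lintegral_congr fun y => ?_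
    simp only [indicator, mem_Ioi]
    split_ifs with h2 h3 h4 h5
    · linarith
    · simp
    · have : 0 < y := h2
      rw [ENNReal.ofReal_rpow_of_nonneg (by positivity) (by norm_num), ← Real.rpow_mul this.le]
      norm_num
    · linarith
    · linarith
    · rfl
  rw [h1, ← ofReal_integral_eq_lintegral_ofReal (integrableOn_Ioi_rpow_of_lt (by norm_num) hR),
    integral_Ioi_rpow_of_lt (by norm_num) hR]
  · rw [← ENNReal.ofReal_ofNat 2, ← ENNReal.ofReal_mul (by norm_num)]
    apply ENNReal.ofReal_le_ofReal
    norm_num [Real.rpow_neg_one]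
    rfl
  · filter_upwards [ae_restrict_mem measurableSet_Ioi] with y hy
    have : 0 < y := hR.trans hy
    positivity

/-- The part of the Riesz kernel `|y| ^ (-1/4)` supported in `|y| ≤ R`. -/
noncomputable def nearKernel (R y : ℝ) : ℝ≥0∞ :=
  if |y| ≤ R then ENNReal.ofReal (|y| ^ (-(1/4) : ℝ)) else 0

/-- The part of the Riesz kernel `|y| ^ (-1/4)` supported in `|y| > R`. -/
noncomputable def farKernel (R y : ℝ) : ℝ≥0∞ :=
  if |y| ≤ R then 0 else ENNReal.ofReal (|y| ^ (-(1/4) : ℝ))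

theorem measurable_nearKernel (R : ℝ) : Measurable (nearKernel R) :=
  Measurable.ite (measurableSet_le (by fun_prop) (by fun_prop)) (by fun_prop) (by fun_prop)

theorem measurable_farKernel (R : ℝ) : Measurable (farKernel R) :=
  Measurable.ite (measurableSet_le (by fun_prop) (by fun_prop)) (by fun_prop) (by fun_prop)

theorem lintegral_riesz_le_three {f : ℝ → ℝ≥0∞} (hf : Measurable f) (R : ℝ) (γ : ℝ≥0∞) (t : ℝ) :
    ∫⁻ u, ENNReal.ofReal (|u - t| ^ (-(1/4) : ℝ)) * f u ≤
      (∫⁻ u, farKernel R (u - t) * f u) + (∫⁻ u, nearKernel R (u - t)) * γ +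
        ∫⁻ u, nearKernel R (u - t) * (if γ < f u then f u else 0) := by
  have hn := measurable_nearKernel R
  have hfar := measurable_farKernel R
  rw [← lintegral_mul_const _ (by fun_prop), ← lintegral_add_left (by fun_prop),
    ← lintegral_add_left (by fun_prop)]
  refine lintegral_mono fun u => ?_
  simp only [nearKernel, farKernel]
  split_ifs with h1 h2
  · exact le_add_left le_rfl
  · simp only [zero_mul, zero_add, mul_zero, add_zero]
    gcongr
    exact not_lt.1 h2
  · simp
  · simp

theorem volume_riesz_le {f : ℝ → ℝ≥0∞} (hf : Measurable f) {r : ℝ} (hr : 0 < r)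
    (hfr : (∫⁻ u, f u ^ (8/7 : ℝ)) ^ (7/8 : ℝ) ≤ ENNReal.ofReal r) {l : ℝ} (hl : 0 < l) :
    ENNReal.ofReal (8 * l ^ 7) *
        volume {t | ENNReal.ofReal l < ∫⁻ u, ENNReal.ofReal (|u - t| ^ (-(1/4) : ℝ)) * f u} ≤
      ENNReal.ofReal (64 * (6 * r) ^ 6) *
        ∫⁻ u, if ENNReal.ofReal (l ^ 7 / (8 * (6 * r) ^ 6)) < f u then f u else 0 := by
  set R : ℝ := (6 * r / l) ^ 8 with hR
  have hR0 : 0 < R := by positivity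
  have hR34 : R ^ (3/4 : ℝ) = (6 * r / l) ^ 6 := by
    rw [hR, ← Real.rpow_natCast, ← Real.rpow_natCast, ← Real.rpow_mul (by positivity)]
    norm_num
  have hn := measurable_nearKernel R
  have hfar := measurable_farKernel R
  set γ : ℝ≥0∞ := ENNReal.ofReal (l ^ 7 / (8 * (6 * r) ^ 6)) with hγ
  set fh : ℝ → ℝ≥0∞ := fun u => if γ < f u then f u else 0 with hfh
  have hfhm : Measurable fh := Measurable.ite (measurableSet_lt measurable_const hf) hf (by fun_prop)
  have far : ∀ t, ∫⁻ u, farKernel R (u - t) * f u ≤ ENNReal.ofReal (l / 3) := by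
    intro t
    have hpq : Real.HolderConjugate 8 (8/7) := by
      rw [Real.holderConjugate_iff]; norm_num
    refine (ENNReal.lintegral_mul_le_Lp_mul_Lq volume hpq (by fun_prop) (by fun_prop)).trans ?_
    have h1 : (∫⁻ u, farKernel R (u - t) ^ (8 : ℝ)) ^ (1 / 8 : ℝ) ≤ ENNReal.ofReal (l / (3 * r)) := by
      rw [one_div, ENNReal.rpow_inv_le_iff (by norm_num)]
      refine (lintegral_far_kernel hR0 t).trans ?_
      rw [ENNReal.ofReal_rpow_of_nonneg (by positivity) (by norm_num)]
      apply ENNReal.ofReal_le_ofReal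
      rw [hR, show (8 : ℝ) = (8 : ℕ) by norm_num, Real.rpow_natCast]
      have h2 : 2 / (6 * r / l) ^ 8 = (l / (3 * r)) ^ 8 * (1 / 128) := by
        field_simp
        norm_num
      rw [h2]
      exact mul_le_of_le_one_right (by positivity) (by norm_num)
    calc _ ≤ ENNReal.ofReal (l / (3 * r)) * ENNReal.ofReal r := by
          gcongr
          rwa [one_div_div]
      _ = ENNReal.ofReal (l / 3) := by
          rw [← ENNReal.ofReal_mul (by positivity)]
          congr 1
          field_simp
  have low : ∀ t, (∫⁻ u, nearKernel R (u - t)) * γ ≤ ENNReal.ofReal (l / 3) := by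
    intro t
    calc _ ≤ ENNReal.ofReal (8 / 3 * R ^ (3/4 : ℝ)) * γ := by
          gcongr
          exact lintegral_near_kernel hR0 t
      _ = ENNReal.ofReal (l / 3) := by
          rw [hγ, ← ENNReal.ofReal_mul (by positivity), hR34]
          congr 1
          field_simp
  have high : ∫⁻ t, ∫⁻ u, nearKernel R (u - t) * fh u ≤
      ENNReal.ofReal (8 / 3 * R ^ (3/4 : ℝ)) * ∫⁻ u, fh u := by
    rw [lintegral_lintegral_swap (by fun_prop), ← lintegral_const_mul _ hfhm]
    refine lintegral_mono fun u => ?_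
    dsimp only
    rw [lintegral_mul_const _ (by fun_prop)]
    gcongr
    refine le_trans (le_of_eq ?_) (lintegral_near_kernel hR0 u)
    refine lintegral_congr fun t => ?_
    rw [nearKernel, abs_sub_comm]
  have sub : {t | ENNReal.ofReal l < ∫⁻ u, ENNReal.ofReal (|u - t| ^ (-(1/4) : ℝ)) * f u} ⊆
      {t | ENNReal.ofReal (l / 3) ≤ ∫⁻ u, nearKernel R (u - t) * fh u} := by
    intro t ht
    simp only [mem_ofPred_eq] at ht ⊢
    by_contra! hcon
    refine absurd ht (not_lt.2 ((lintegral_riesz_le_three hf R γ t).trans ?_))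
    calc _ ≤ ENNReal.ofReal (l / 3) + ENNReal.ofReal (l / 3) + ENNReal.ofReal (l / 3) :=
          add_le_add (add_le_add (far t) (low t)) hcon.le
      _ = ENNReal.ofReal l := by
          rw [← ENNReal.ofReal_add (by positivity) (by positivity),
            ← ENNReal.ofReal_add (by positivity) (by positivity)]
          congr 1
          ring
  calc _ ≤ ENNReal.ofReal (8 * l ^ 7) *
        volume {t | ENNReal.ofReal (l / 3) ≤ ∫⁻ u, nearKernel R (u - t) * fh u} := by
        gcongr
    _ = ENNReal.ofReal (24 * l ^ 6) * (ENNReal.ofReal (l / 3) *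
        volume {t | ENNReal.ofReal (l / 3) ≤ ∫⁻ u, nearKernel R (u - t) * fh u}) := by
        rw [← mul_assoc, ← ENNReal.ofReal_mul (by positivity)]
        congr 2
        ring
    _ ≤ ENNReal.ofReal (24 * l ^ 6) * (ENNReal.ofReal (8 / 3 * R ^ (3/4 : ℝ)) * ∫⁻ u, fh u) := by
        refine mul_le_mul_right ((mul_meas_ge_le_lintegral ?_ _).trans high) _
        exact Measurable.lintegral_prod_right (by fun_prop)
    _ = _ := by
        rw [← mul_assoc, ← ENNReal.ofReal_mul (by positivity), hR34]
        congr 2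
        field_simp
        norm_num

theorem volume_Ioi_ofReal_lt_le (B : ℝ≥0∞) :
    volume.restrict (Ioi (0 : ℝ)) {l | ENNReal.ofReal l < B} ≤ B := by
  rcases eq_or_ne B ∞ with rfl | hB
  · exact le_top
  · lift B to NNReal using hB
    rw [Measure.restrict_apply (measurableSet_lt (by fun_prop) (by fun_prop))]
    calc _ ≤ volume (Ioo (0 : ℝ) B) := by
          refine measure_mono fun l hl => ⟨hl.2, ?_⟩
          have := hl.1
          simp only [mem_ofPred_eq] at this
          rw [← ENNReal.ofReal_coe_nnreal] at this
          exact (ENNReal.ofReal_lt_ofReal_iff_of_nonneg (le_of_lt hl.2)).1 this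
      _ = B := by simp

/-- The constant in the Hardy–Littlewood–Sobolev inequality below. -/
noncomputable def hlsConst : ℝ := 64 * 6 ^ 6 * (8 * 6 ^ 6) ^ (1/7 : ℝ)

theorem hardy_littlewood_sobolev {f : ℝ → ℝ≥0∞} (hf : Measurable f) {r : ℝ} (hr : 0 < r)
    (hfr : (∫⁻ u, f u ^ (8/7 : ℝ)) ^ (7/8 : ℝ) ≤ ENNReal.ofReal r) :
    ∫⁻ t, (∫⁻ u, ENNReal.ofReal (|u - t| ^ (-(1/4) : ℝ)) * f u) ^ 8 ≤
      ENNReal.ofReal (hlsConst * r ^ 8) := by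
  have hm : Measurable fun t : ℝ => ∫⁻ u, ENNReal.ofReal (|u - t| ^ (-(1/4) : ℝ)) * f u :=
    Measurable.lintegral_prod_right (by fun_prop)
  have hfr' : ∫⁻ u, f u ^ (8/7 : ℝ) ≤ ENNReal.ofReal (r ^ (8/7 : ℝ)) := by
    rw [← ENNReal.ofReal_rpow_of_nonneg hr.le (by norm_num)]
    calc _ = ((∫⁻ u, f u ^ (8/7 : ℝ)) ^ (7/8 : ℝ)) ^ (8/7 : ℝ) := by
          rw [← ENNReal.rpow_mul]; norm_num
      _ ≤ _ := by gcongr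
  have key : ∀ u, ∫⁻ l in Ioi (0 : ℝ),
      (if ENNReal.ofReal (l ^ 7 / (8 * (6 * r) ^ 6)) < f u then f u else 0) ≤
      ENNReal.ofReal ((8 * (6 * r) ^ 6) ^ (1/7 : ℝ)) * f u ^ (8/7 : ℝ) := by
    intro u
    calc _ ≤ ∫⁻ l in Ioi (0 : ℝ), ({l : ℝ | ENNReal.ofReal l <
          (ENNReal.ofReal (8 * (6 * r) ^ 6) * f u) ^ (1/7 : ℝ)}.indicator (fun _ => f u)) l := by
          refine setLIntegral_mono' measurableSet_Ioi fun l hl => ?_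
          split_ifs with h
          · rw [indicator_of_mem]
            have hl' : (0 : ℝ) < l := hl
            simp only [mem_ofPred_eq]
            rw [one_div, ENNReal.lt_rpow_inv_iff (by norm_num),
              ENNReal.ofReal_rpow_of_nonneg hl'.le (by norm_num)]
            calc _ = ENNReal.ofReal (8 * (6 * r) ^ 6) *
                  ENNReal.ofReal (l ^ 7 / (8 * (6 * r) ^ 6)) := by
                  rw [← ENNReal.ofReal_mul (by positivity)]
                  congr 1
                  rw [show (7 : ℝ) = (7 : ℕ) by norm_num, Real.rpow_natCast]
                  field_simp
              _ < _ := by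
                  refine ENNReal.mul_lt_mul_right ?_ ENNReal.ofReal_ne_top h
                  simp
                  positivity
          · exact zero_le
      _ = f u * volume.restrict (Ioi (0 : ℝ)) {l : ℝ | ENNReal.ofReal l <
          (ENNReal.ofReal (8 * (6 * r) ^ 6) * f u) ^ (1/7 : ℝ)} := by
          rw [lintegral_indicator_const (measurableSet_lt (by fun_prop) (by fun_prop))]
      _ ≤ f u * (ENNReal.ofReal (8 * (6 * r) ^ 6) * f u) ^ (1/7 : ℝ) := by
          gcongr
          exact volume_Ioi_ofReal_lt_le _
      _ = _ := by
          rw [ENNReal.mul_rpow_of_nonneg _ _ (by norm_num),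
            ENNReal.ofReal_rpow_of_nonneg (by positivity) (by norm_num), mul_left_comm]
          congr 1
          rw [show (8/7 : ℝ) = 1 + 1/7 by norm_num,
            ENNReal.rpow_add_of_nonneg _ _ (by norm_num) (by norm_num), ENNReal.rpow_one]
  calc _ ≤ _ := lintegral_pow_eight_le hm
    _ ≤ ∫⁻ l in Ioi (0 : ℝ), ENNReal.ofReal (64 * (6 * r) ^ 6) *
        ∫⁻ u, if ENNReal.ofReal (l ^ 7 / (8 * (6 * r) ^ 6)) < f u then f u else 0 :=
        setLIntegral_mono' measurableSet_Ioi fun l hl => volume_riesz_le hf hr hfr hl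
    _ = ENNReal.ofReal (64 * (6 * r) ^ 6) * ∫⁻ u, ∫⁻ l in Ioi (0 : ℝ),
        (if ENNReal.ofReal (l ^ 7 / (8 * (6 * r) ^ 6)) < f u then f u else 0) := by
        have hmm : Measurable fun z : ℝ × ℝ =>
            if ENNReal.ofReal (z.1 ^ 7 / (8 * (6 * r) ^ 6)) < f z.2 then f z.2 else 0 :=
          Measurable.ite (measurableSet_lt (by fun_prop) (by fun_prop)) (by fun_prop) (by fun_prop)
        rw [lintegral_const_mul' _ _ ENNReal.ofReal_ne_top, lintegral_lintegral_swap]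
        exact hmm.aemeasurable
    _ ≤ ENNReal.ofReal (64 * (6 * r) ^ 6) *
        ∫⁻ u, ENNReal.ofReal ((8 * (6 * r) ^ 6) ^ (1/7 : ℝ)) * f u ^ (8/7 : ℝ) := by
        gcongr with u
        exact key u
    _ ≤ ENNReal.ofReal (64 * (6 * r) ^ 6) * (ENNReal.ofReal ((8 * (6 * r) ^ 6) ^ (1/7 : ℝ)) *
        ENNReal.ofReal (r ^ (8/7 : ℝ))) := by
        rw [lintegral_const_mul' _ _ ENNReal.ofReal_ne_top]
        gcongr
    _ = _ := by
        rw [← ENNReal.ofReal_mul (by positivity), ← ENNReal.ofReal_mul (by positivity)]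
        congr 1
        have h1 : (8 * (6 * r) ^ 6) ^ (1/7 : ℝ) = (8 * 6 ^ 6) ^ (1/7 : ℝ) * r ^ (6/7 : ℝ) := by
          rw [mul_pow, ← mul_assoc, Real.mul_rpow (by positivity) (by positivity),
            ← Real.rpow_natCast r, ← Real.rpow_mul hr.le]
          norm_num
        have h2 : r ^ (6/7 : ℝ) * r ^ (8/7 : ℝ) = r ^ 2 := by
          rw [← Real.rpow_add hr, ← Real.rpow_natCast]; norm_num
        rw [h1, hlsConst, mul_assoc ((8 * 6 ^ 6 : ℝ) ^ (1/7 : ℝ)), h2]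
        ring

theorem intervalIntegral_starRingEnd (f : ℝ → ℂ) (c d : ℝ) :
    ∫ x in c..d, (starRingEnd ℂ) (f x) = (starRingEnd ℂ) (∫ x in c..d, f x) := by
  simp only [intervalIntegral, map_sub, integral_conj]

/-- First derivative test for oscillatory integrals with convex phase. -/
theorem norm_integral_cexp_le_of_deriv_ge {p p' p'' : ℝ → ℝ} {c d μ : ℝ} (hcd : c ≤ d)
    (hμ : 0 < μ) (hp : ∀ x, HasDerivAt p (p' x) x) (hp' : ∀ x, HasDerivAt p' (p'' x) x)
    (hp'' : Continuous p'') (hpos : ∀ x ∈ Icc c d, 0 ≤ p'' x)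
    (h : (∀ x ∈ Icc c d, μ ≤ p' x) ∨ (∀ x ∈ Icc c d, p' x ≤ -μ)) :
    ‖∫ x in c..d, Complex.exp (Complex.I * (p x : ℝ))‖ ≤ 3 / μ := by
  have hne : ∀ x ∈ Icc c d, p' x ≠ 0 := by
    intro x hx h0
    rcases h with h | h <;> linarith [h x hx]
  have hinv : ∀ x ∈ Icc c d, |(p' x)⁻¹| ≤ 1 / μ := by
    intro x hx
    rw [abs_inv, ← one_div]
    apply one_div_le_one_div_of_le hμ
    rcases h with h | h
    · exact (h x hx).trans (le_abs_self _)
    · have := neg_le_abs (p' x)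
      linarith [h x hx]
  have hpc : Continuous p := continuous_iff_continuousAt.2 fun x => (hp x).continuousAt
  have hpc' : Continuous p' := continuous_iff_continuousAt.2 fun x => (hp' x).continuousAt
  have hcI : c ∈ Icc c d := left_mem_Icc.2 hcd
  have hdI : d ∈ Icc c d := right_mem_Icc.2 hcd
  have hcont : ContinuousOn (fun x => p'' x / p' x ^ 2) (uIcc c d) := by
    rw [uIcc_of_le hcd]
    exact hp''.continuousOn.div (by fun_prop) fun x hx => pow_ne_zero 2 (hne x hx)
  have hcont2 : ContinuousOn (fun x => Complex.exp (Complex.I * (p x : ℝ)) *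
      ((p'' x / p' x ^ 2 : ℝ) : ℂ)) (uIcc c d) :=
    ContinuousOn.mul (by fun_prop) (Complex.continuous_ofReal.comp_continuousOn hcont)
  have hF : ∀ x ∈ uIcc c d, HasDerivAt
      (fun x => Complex.exp (Complex.I * (p x : ℝ)) * (((p' x)⁻¹ : ℝ) : ℂ))
      (Complex.I * Complex.exp (Complex.I * (p x : ℝ)) -
        Complex.exp (Complex.I * (p x : ℝ)) * ((p'' x / p' x ^ 2 : ℝ) : ℂ)) x := by
    intro x hx
    rw [uIcc_of_le hcd] at hx
    have h1 := (((hp x).ofReal_comp).const_mul Complex.I).cexp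
    have h2 := ((hp' x).inv (hne x hx)).ofReal_comp
    refine (h1.mul h2).congr_deriv ?_
    have := hne x hx
    have h3 : (p' x : ℂ) ≠ 0 := by exact_mod_cast this
    simp only [Pi.inv_apply]
    push_cast
    field_simp
    ring
  have hG : ∀ x ∈ uIcc c d, HasDerivAt (fun x => -(p' x)⁻¹) (p'' x / p' x ^ 2) x := by
    intro x hx
    rw [uIcc_of_le hcd] at hx
    refine ((hp' x).inv (hne x hx)).neg.congr_deriv ?_
    ring
  have h_integrable1 : IntervalIntegrable (fun x => Complex.I * Complex.exp (Complex.I * (p x : ℝ)))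
      volume c d := Continuous.intervalIntegrable (by fun_prop) _ _
  have e1 := intervalIntegral.integral_eq_sub_of_hasDerivAt hF
    (h_integrable1.sub hcont2.intervalIntegrable)
  have e2 := intervalIntegral.integral_eq_sub_of_hasDerivAt hG hcont.intervalIntegrable
  rw [intervalIntegral.integral_sub h_integrable1 hcont2.intervalIntegrable,
    intervalIntegral.integral_const_mul] at e1
  have hexp : ∀ x : ℝ, ‖Complex.exp (Complex.I * (x : ℝ))‖ = 1 := fun x => by
    rw [mul_comm]; exact Complex.norm_exp_ofReal_mul_I x
  have b1 : ‖∫ x in c..d, Complex.exp (Complex.I * (p x : ℝ)) *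
      ((p'' x / p' x ^ 2 : ℝ) : ℂ)‖ ≤ 1 / μ := by
    calc _ ≤ ∫ x in c..d, p'' x / p' x ^ 2 := by
          refine intervalIntegral.norm_integral_le_of_norm_le hcd (ae_of_all _ fun x hx => ?_)
            hcont.intervalIntegrable
          rw [norm_mul, hexp, one_mul, Complex.norm_real, Real.norm_of_nonneg]
          exact div_nonneg (hpos x (Ioc_subset_Icc_self hx)) (sq_nonneg _)
      _ ≤ 1 / μ := by
          rw [e2]
          rcases h with h | h
          · have h1 := (abs_le.1 (hinv c hcI)).2
            have h2 : 0 < (p' d)⁻¹ := inv_pos.2 (hμ.trans_le (h d hdI))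
            linarith
          · have h1 := (abs_le.1 (hinv d hdI)).1
            have h2 : (p' c)⁻¹ < 0 := inv_lt_zero.2 (by linarith [h c hcI])
            linarith
  have b2 : ∀ x ∈ Icc c d, ‖Complex.exp (Complex.I * (p x : ℝ)) * (((p' x)⁻¹ : ℝ) : ℂ)‖ ≤ 1 / μ := by
    intro x hx
    rw [norm_mul, hexp, one_mul, Complex.norm_real]
    exact hinv x hx
  calc ‖∫ x in c..d, Complex.exp (Complex.I * (p x : ℝ))‖
      = ‖Complex.I * ∫ x in c..d, Complex.exp (Complex.I * (p x : ℝ))‖ := by simp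
    _ = ‖_ - _ + ∫ x in c..d, Complex.exp (Complex.I * (p x : ℝ)) *
      ((p'' x / p' x ^ 2 : ℝ) : ℂ)‖ := by rw [← e1, sub_add_cancel]
    _ ≤ 1 / μ + 1 / μ + 1 / μ :=
        (norm_add_le _ _).trans (add_le_add ((norm_sub_le _ _).trans
          (add_le_add (b2 d hdI) (b2 c hcI))) b1)
    _ = 3 / μ := by ring

theorem norm_integral_cexp_cubic_le_of_sq {a b c d δ : ℝ} (hcd : c ≤ d) (hc : 0 ≤ c) (ha : 0 < a)
    (hδ : 0 < δ)
    (h : (∀ x ∈ Icc c d, 3 / δ ≤ b + 3 * a * x ^ 2) ∨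
      (∀ x ∈ Icc c d, b + 3 * a * x ^ 2 ≤ -(3 / δ))) :
    ‖∫ x in c..d, Complex.exp (Complex.I * ((b * x + a * x ^ 3 : ℝ) : ℂ))‖ ≤ δ := by
  have hp : ∀ x : ℝ, HasDerivAt (fun x => b * x + a * x ^ 3) (b + 3 * a * x ^ 2) x := by
    intro x
    refine (((hasDerivAt_id x).const_mul b).add ((hasDerivAt_pow 3 x).const_mul a)).congr_deriv ?_
    norm_num
    ring
  have hp' : ∀ x : ℝ, HasDerivAt (fun x => b + 3 * a * x ^ 2) (6 * a * x) x := by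
    intro x
    refine (((hasDerivAt_pow 2 x).const_mul (3 * a)).const_add b).congr_deriv ?_
    norm_num
    ring
  have := norm_integral_cexp_le_of_deriv_ge hcd (μ := 3 / δ) (by positivity) hp hp' (by fun_prop)
    (fun x hx => by have := hc.trans hx.1; positivity) h
  rwa [div_div_cancel₀ (by norm_num)] at this

theorem norm_integral_cexp_le_sub (p : ℝ → ℝ) {c d : ℝ} (hcd : c ≤ d) :
    ‖∫ x in c..d, Complex.exp (Complex.I * (p x : ℝ))‖ ≤ d - c := by
  have := intervalIntegral.norm_integral_le_of_norm_le_const (a := c) (b := d) (C := 1)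
    (f := fun x => Complex.exp (Complex.I * (p x : ℝ)))
    (fun x _ => by rw [mul_comm, Complex.norm_exp_ofReal_mul_I])
  rwa [one_mul, abs_of_nonneg (by linarith)] at this

theorem norm_integral_cexp_cubic_le_half {a b δ N : ℝ} (ha : 0 < a) (hδ : 0 < δ)
    (haδ : a * δ ^ 3 = 1) (hN : 0 ≤ N) :
    ‖∫ x in (0 : ℝ)..N, Complex.exp (Complex.I * ((b * x + a * x ^ 3 : ℝ) : ℂ))‖ ≤ 5 * δ := by
  have hμ : 3 / δ = 3 * a * δ ^ 2 := by
    field_simp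
    linear_combination -haδ
  set z : ℝ := Real.sqrt (max (-b) 0 / (3 * a)) with hz
  have hz0 : 0 ≤ z := Real.sqrt_nonneg _
  have hzsq : 3 * a * z ^ 2 = max (-b) 0 := by
    rw [hz, Real.sq_sqrt (by positivity)]
    field_simp
  set u1 : ℝ := min δ N with hu1
  set u2 : ℝ := max u1 (min (z - δ) N) with hu2
  set u3 : ℝ := max u2 (min (z + δ) N) with hu3
  have h01 : 0 ≤ u1 := le_min hδ.le hN
  have h12 : u1 ≤ u2 := le_max_left _ _
  have h23 : u2 ≤ u3 := le_max_left _ _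
  have h1N : u1 ≤ N := min_le_right _ _
  have h2N : u2 ≤ N := max_le h1N (min_le_right _ _)
  have h3N : u3 ≤ N := max_le h2N (min_le_right _ _)
  set E : ℝ → ℂ := fun x => Complex.exp (Complex.I * ((b * x + a * x ^ 3 : ℝ) : ℂ)) with hE
  have hi : ∀ c d, IntervalIntegrable E volume c d := fun c d =>
    Continuous.intervalIntegrable (by fun_prop) _ _
  have split : ∫ x in (0 : ℝ)..N, E x = (∫ x in (0 : ℝ)..u1, E x) + (∫ x in u1..u2, E x) +
      (∫ x in u2..u3, E x) + ∫ x in u3..N, E x := by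
    rw [intervalIntegral.integral_add_adjacent_intervals (hi _ _) (hi _ _),
      intervalIntegral.integral_add_adjacent_intervals (hi _ _) (hi _ _),
      intervalIntegral.integral_add_adjacent_intervals (hi _ _) (hi _ _)]
  have b1 : ‖∫ x in (0 : ℝ)..u1, E x‖ ≤ δ :=
    (norm_integral_cexp_le_sub _ h01).trans (by linarith [min_le_left δ N])
  have b2 : ‖∫ x in u1..u2, E x‖ ≤ δ := by
    rcases h12.eq_or_lt with h | h
    · rw [h, intervalIntegral.integral_same, norm_zero]; exact hδ.le
    · have hu2' : u2 ≤ z - δ := by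
        rcases le_max_iff.1 (le_refl u2) with h' | h'
        · linarith
        · exact h'.trans (min_le_left _ _)
      have hu1' : δ ≤ u1 := by
        rw [hu1]
        refine le_min le_rfl ?_
        by_contra! hcon
        have : u1 = N := min_eq_right hcon.le
        linarith
      refine norm_integral_cexp_cubic_le_of_sq h12 h01 ha hδ (Or.inr fun x hx => ?_)
      have hx1 : δ ≤ x := hu1'.trans hx.1
      have hx2 : x + δ ≤ z := by linarith [hx.2]
      have hzpos : 0 < z := by linarith
      have hb : 3 * a * z ^ 2 = -b := by
        rw [hzsq]
        refine max_eq_left ?_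
        by_contra! hcon
        rw [max_eq_right hcon.le] at hzsq
        have : 0 < 3 * a * z ^ 2 := by positivity
        linarith
      rw [hμ]
      have : x ^ 2 + δ ^ 2 ≤ z ^ 2 := by nlinarith
      nlinarith
  have b3 : ‖∫ x in u2..u3, E x‖ ≤ 2 * δ := by
    refine (norm_integral_cexp_le_sub _ h23).trans ?_
    have h1 : min (z - δ) N ≤ u2 := le_max_right _ _
    rw [sub_le_iff_le_add]
    refine max_le (by linarith) ?_
    rcases min_le_iff.1 h1 with h | h
    · exact (min_le_left _ _).trans (by linarith)
    · exact (min_le_right _ _).trans (by linarith)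
  have b4 : ‖∫ x in u3..N, E x‖ ≤ δ := by
    rcases h3N.eq_or_lt with h | h
    · rw [h, intervalIntegral.integral_same, norm_zero]; exact hδ.le
    · have h1 : min (z + δ) N ≤ u3 := le_max_right _ _
      have hzu : z + δ ≤ u3 := by
        rcases min_le_iff.1 h1 with h' | h'
        · exact h'
        · linarith
      refine norm_integral_cexp_cubic_le_of_sq h3N (by linarith) ha hδ (Or.inl fun x hx => ?_)
      have hx1 : z + δ ≤ x := hzu.trans hx.1
      rw [hμ]
      have h2 : z ^ 2 + δ ^ 2 ≤ x ^ 2 := by nlinarith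
      have h3 := le_max_left (-b) 0
      nlinarith
  rw [split]
  refine (norm_add_le _ _).trans ((add_le_add_left ((norm_add_le _ _).trans
    (add_le_add_left (norm_add_le _ _) _)) _).trans ?_)
  linarith

theorem norm_integral_cexp_cubic_le_of_pos {a N : ℝ} (b : ℝ) (ha : 0 < a) (hN : 0 ≤ N) :
    ‖∫ x in (-N)..N, Complex.exp (Complex.I * ((b * x + a * x ^ 3 : ℝ) : ℂ))‖ ≤
      10 * a ^ (-(1/3) : ℝ) := by
  set δ : ℝ := a ^ (-(1/3) : ℝ) with hδdef
  have hδ : 0 < δ := by positivity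
  have haδ : a * δ ^ 3 = 1 := by
    rw [hδdef, ← Real.rpow_natCast, ← Real.rpow_mul ha.le]
    norm_num
    rw [Real.rpow_neg_one]
    field_simp
  set E : ℝ → ℂ := fun x => Complex.exp (Complex.I * ((b * x + a * x ^ 3 : ℝ) : ℂ)) with hE
  have hi : ∀ c d, IntervalIntegrable E volume c d := fun c d =>
    Continuous.intervalIntegrable (by fun_prop) _ _
  have b1 := norm_integral_cexp_cubic_le_half (b := b) ha hδ haδ hN
  have h2 : ∫ x in (-N)..0, E x = (starRingEnd ℂ) (∫ x in (0 : ℝ)..N, E x) := by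
    rw [← intervalIntegral_starRingEnd]
    have := intervalIntegral.integral_comp_neg (a := 0) (b := N) E
    rw [neg_zero] at this
    rw [← this]
    refine intervalIntegral.integral_congr fun x _ => ?_
    simp only [hE]
    rw [← Complex.exp_conj]
    congr 1
    simp
    ring
  rw [← intervalIntegral.integral_add_adjacent_intervals (hi (-N) 0) (hi 0 N), h2]
  refine (norm_add_le _ _).trans ?_
  rw [Complex.norm_conj]
  linarith

/-- Van der Corput bound for truncated Airy integrals. -/
theorem norm_integral_cexp_cubic_le {a N : ℝ} (b : ℝ) (ha : a ≠ 0) (hN : 0 ≤ N) :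
    ‖∫ x in (-N)..N, Complex.exp (Complex.I * ((b * x + a * x ^ 3 : ℝ) : ℂ))‖ ≤
      10 * |a| ^ (-(1/3) : ℝ) := by
  rcases lt_or_gt_of_ne ha with h | h
  · rw [abs_of_neg h]
    refine le_trans (le_of_eq ?_) (norm_integral_cexp_cubic_le_of_pos (-b) (neg_pos.2 h) hN)
    rw [← Complex.norm_conj, ← intervalIntegral_starRingEnd]
    congr 1
    refine intervalIntegral.integral_congr fun x _ => ?_
    rw [← Complex.exp_conj]
    congr 1
    simp
    ring
  · rw [abs_of_pos h]
    exact norm_integral_cexp_cubic_le_of_pos b h hN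

open scoped SchwartzMap FourierTransform ContDiff

theorem iteratedDeriv_cexp_I_mul (n : ℕ) :
    iteratedDeriv n (fun t : ℝ => Complex.exp (Complex.I * t)) =
      fun t : ℝ => Complex.I ^ n * Complex.exp (Complex.I * t) := by
  induction n with
  | zero => simp
  | succ n ih =>
    rw [iteratedDeriv_succ, ih]
    funext t
    have h : HasDerivAt (fun t : ℝ => Complex.exp (Complex.I * t))
        (Complex.exp (Complex.I * t) * (Complex.I * 1)) t :=
      ((Complex.ofRealCLM.hasDerivAt (x := t)).const_mul Complex.I).cexp
    rw [(h.const_mul (Complex.I ^ n)).deriv]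
    ring

theorem hasTemperateGrowth_cexp_I_mul :
    Function.HasTemperateGrowth fun t : ℝ => Complex.exp (Complex.I * t) := by
  refine ⟨(contDiff_const.mul Complex.ofRealCLM.contDiff).cexp, fun n => ⟨0, 1, fun t => ?_⟩⟩
  rw [norm_iteratedFDeriv_eq_norm_iteratedDeriv, iteratedDeriv_cexp_I_mul]
  simp [mul_comm Complex.I, Complex.norm_exp_ofReal_mul_I]

/-- The Fourier multiplier of the Airy group. -/
noncomputable def airyMultiplier (a η : ℝ) : ℂ := Complex.exp (Complex.I * (a * η ^ 3 : ℝ))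

theorem norm_airyMultiplier (a η : ℝ) : ‖airyMultiplier a η‖ = 1 := by
  rw [airyMultiplier, mul_comm, Complex.norm_exp_ofReal_mul_I]

theorem hasTemperateGrowth_airyMultiplier (a : ℝ) :
    Function.HasTemperateGrowth (airyMultiplier a) := by
  have h : Function.HasTemperateGrowth fun η : ℝ => a * η ^ 3 :=
    (Function.HasTemperateGrowth.const a).mul (Function.HasTemperateGrowth.id'.pow 3)
  exact hasTemperateGrowth_cexp_I_mul.comp h

/-- The Airy group acting on Schwartz functions. -/
noncomputable def airy (a : ℝ) : 𝓢(ℝ, ℂ) →L[ℂ] 𝓢(ℝ, ℂ) :=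
  SchwartzMap.fourierMultiplierCLM ℂ (airyMultiplier a)

theorem airy_apply_eq_integral (a : ℝ) (f : 𝓢(ℝ, ℂ)) (x : ℝ) :
    airy a f x = ∫ η : ℝ, Complex.exp (Complex.I * (2 * Real.pi * x * η + a * η ^ 3 : ℝ)) *
      𝓕 (f : ℝ → ℂ) η := by
  rw [airy, SchwartzMap.fourierMultiplierCLM_apply, SchwartzMap.fourierInv_coe, Real.fourierInv_eq']
  refine integral_congr_ae (ae_of_all _ fun η => ?_)
  simp only [SchwartzMap.smulLeftCLM_apply_apply (hasTemperateGrowth_airyMultiplier a),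
    SchwartzMap.fourier_coe, airyMultiplier, smul_eq_mul]
  rw [← mul_assoc, ← Complex.exp_add]
  congr 2
  simp
  ring

theorem lintegral_enorm_sq_eq (g : 𝓢(ℝ, ℂ)) :
    ∫⁻ x, ‖g x‖ₑ ^ 2 = ENNReal.ofReal (∫ x, ‖g x‖ ^ 2) := by
  rw [ofReal_integral_eq_lintegral_ofReal ((g.memLp 2 volume).integrable_norm_pow (by norm_num))
    (ae_of_all _ fun x => by positivity)]
  refine lintegral_congr fun x => ?_
  rw [ENNReal.ofReal_pow (norm_nonneg _), ofReal_norm]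

theorem lintegral_airy_sq (a : ℝ) (f : 𝓢(ℝ, ℂ)) :
    ∫⁻ x, ‖airy a f x‖ₑ ^ 2 = ∫⁻ x, ‖f x‖ₑ ^ 2 := by
  rw [lintegral_enorm_sq_eq, lintegral_enorm_sq_eq, airy, SchwartzMap.fourierMultiplierCLM_apply,
    ← SchwartzMap.integral_norm_sq_fourier, ← SchwartzMap.integral_norm_sq_fourier f,
    FourierTransform.fourier_fourierInv_eq]
  simp only [SchwartzMap.smulLeftCLM_apply_apply (hasTemperateGrowth_airyMultiplier a), norm_smul,
    norm_airyMultiplier, one_mul]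

theorem norm_truncated_airy_le {a : ℝ} (ha : a ≠ 0) (f : 𝓢(ℝ, ℂ)) (x : ℝ) {N : ℝ} (hN : 0 ≤ N) :
    ‖∫ η in (-N)..N, Complex.exp (Complex.I * (2 * Real.pi * x * η + a * η ^ 3 : ℝ)) *
      𝓕 (f : ℝ → ℂ) η‖ ≤ 10 * |a| ^ (-(1/3) : ℝ) * ∫ y, ‖f y‖ := by
  have hNN : -N ≤ N := by linarith
  have hexp : ∀ x : ℝ, ‖Complex.exp (Complex.I * (x : ℝ))‖ = 1 := fun x => by
    rw [mul_comm]; exact Complex.norm_exp_ofReal_mul_I x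
  have hker : ∀ η y : ℝ, Complex.exp (Complex.I * (2 * Real.pi * x * η + a * η ^ 3 : ℝ)) *
      (Complex.exp (((-2 * Real.pi * y * η : ℝ) : ℂ) * Complex.I) • f y) =
      Complex.exp (Complex.I * ((2 * Real.pi * (x - y)) * η + a * η ^ 3 : ℝ)) * f y := by
    intro η y
    rw [smul_eq_mul, ← mul_assoc, ← Complex.exp_add]
    congr 2
    push_cast
    ring
  have h_integrable : Integrable (Function.uncurry fun η y : ℝ =>
      Complex.exp (Complex.I * ((2 * Real.pi * (x - y)) * η + a * η ^ 3 : ℝ)) * f y)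
      ((volume.restrict (Ioc (-N) N)).prod volume) := by
    have h1 : Integrable (fun z : ℝ × ℝ => (1 : ℂ) * f z.2)
        ((volume.restrict (Ioc (-N) N)).prod volume) :=
      Integrable.mul_prod (integrable_const _) f.integrable
    refine h1.mono ?_ (ae_of_all _ fun z => ?_)
    · have := f.continuous
      exact Continuous.aestronglyMeasurable (by fun_prop)
    · simp only [Function.uncurry, norm_mul, hexp, norm_one, le_refl]
  have e : ∫ η in (-N)..N, Complex.exp (Complex.I * (2 * Real.pi * x * η + a * η ^ 3 : ℝ)) *
      𝓕 (f : ℝ → ℂ) η = ∫ y, (∫ η in (-N)..N,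
        Complex.exp (Complex.I * ((2 * Real.pi * (x - y)) * η + a * η ^ 3 : ℝ))) * f y := by
    simp only [intervalIntegral.integral_of_le hNN, Real.fourier_real_eq_integral_exp_smul,
      ← integral_const_mul, ← integral_mul_const, hker]
    exact integral_integral_swap h_integrable
  rw [e, ← integral_const_mul]
  refine norm_integral_le_of_norm_le (f.integrable.norm.const_mul _) (ae_of_all _ fun y => ?_)
  rw [norm_mul]
  gcongr
  exact norm_integral_cexp_cubic_le _ ha hN

/-- Dispersive estimate for the Airy group. -/
theorem enorm_airy_le {a : ℝ} (ha : a ≠ 0) (f : 𝓢(ℝ, ℂ)) (x : ℝ) :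
    ‖airy a f x‖ₑ ≤ ENNReal.ofReal (10 * |a| ^ (-(1/3) : ℝ)) * ∫⁻ y, ‖f y‖ₑ := by
  have hexp : ∀ x : ℝ, ‖Complex.exp (Complex.I * (x : ℝ))‖ = 1 := fun x => by
    rw [mul_comm]; exact Complex.norm_exp_ofReal_mul_I x
  have h_integrable : Integrable (fun η : ℝ => Complex.exp
      (Complex.I * (2 * Real.pi * x * η + a * η ^ 3 : ℝ)) * 𝓕 (f : ℝ → ℂ) η) := by
    rw [← SchwartzMap.fourier_coe]
    refine (𝓕 f).integrable.mono ?_ (ae_of_all _ fun η => ?_)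
    · have := (𝓕 f).continuous
      exact Continuous.aestronglyMeasurable (by fun_prop)
    · rw [norm_mul, hexp, one_mul]
  have hlim := (intervalIntegral_tendsto_integral h_integrable Filter.tendsto_neg_atTop_atBot
    Filter.tendsto_id).norm
  rw [← airy_apply_eq_integral] at hlim
  have hle : ‖airy a f x‖ ≤ 10 * |a| ^ (-(1/3) : ℝ) * ∫ y, ‖f y‖ := by
    refine le_of_tendsto hlim ?_
    filter_upwards [Filter.eventually_ge_atTop 0] with N hN
    exact norm_truncated_airy_le ha f x hN
  rw [← ofReal_integral_norm_eq_lintegral_enorm f.integrable,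
    ← ENNReal.ofReal_mul (by positivity), ← ofReal_norm]
  exact ENNReal.ofReal_le_ofReal hle

theorem SchwartzMap.exists_add_eq_of_pos (f : 𝓢(ℝ, ℂ)) {γ : ℝ} (hγ : 0 < γ) :
    ∃ g k : 𝓢(ℝ, ℂ), g + k = f ∧ (∀ x, ‖g x‖ ≤ ‖f x‖) ∧ (∀ x, ‖f x‖ < γ → g x = 0) ∧
      (∀ x, ‖k x‖ ≤ ‖f x‖) ∧ ∀ x, 2 * γ < ‖f x‖ → k x = 0 := by
  set χ : ℝ → ℝ := fun x => Real.smoothTransition (‖f x‖ ^ 2 / γ ^ 2 - 1) with hχ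
  have h0 : ∀ x, ‖f x‖ < γ → χ x = 0 := fun x hx => by
    refine Real.smoothTransition.zero_of_nonpos ?_
    rw [sub_nonpos, div_le_one (by positivity)]
    gcongr
  have h1 : ∀ x, 2 * γ < ‖f x‖ → χ x = 1 := fun x hx => by
    refine Real.smoothTransition.one_of_one_le ?_
    rw [le_sub_iff_add_le, le_div_iff₀ (by positivity)]
    nlinarith
  have hχ0 : ∀ x, 0 ≤ χ x := fun x => Real.smoothTransition.nonneg _
  have hχ1 : ∀ x, χ x ≤ 1 := fun x => Real.smoothTransition.le_one _
  have hsupp : HasCompactSupport fun x => χ x • f x := by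
    have h : ∀ᶠ x in Filter.cocompact ℝ, ‖f x‖ < γ := by
      have := (f.tendsto_cocompact).norm
      rw [norm_zero] at this
      exact this.eventually (gt_mem_nhds hγ)
    rw [hasCompactSupport_iff_eventuallyEq]
    rw [← Filter.coclosedCompact_eq_cocompact] at h
    filter_upwards [h] with x hx
    simp [h0 x hx]
  have hsmooth : ContDiff ℝ ∞ fun x => χ x • f x := by
    have hf := f.smooth ⊤
    have hχs : ContDiff ℝ ∞ χ :=
      Real.smoothTransition.contDiff.comp (((hf.norm_sq ℝ).div_const _).sub contDiff_const)
    exact hχs.smul hf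
  refine ⟨hsupp.toSchwartzMap hsmooth, f - hsupp.toSchwartzMap hsmooth, by simp, fun x => ?_,
    fun x hx => ?_, fun x => ?_, fun x hx => ?_⟩
  · change ‖χ x • f x‖ ≤ _
    rw [norm_smul, Real.norm_of_nonneg (hχ0 x)]
    exact mul_le_of_le_one_left (norm_nonneg _) (hχ1 x)
  · change χ x • f x = 0
    simp [h0 x hx]
  · change ‖f x - χ x • f x‖ ≤ _
    have : f x - χ x • f x = (1 - χ x) • f x := by rw [sub_smul, one_smul]
    rw [this, norm_smul, Real.norm_of_nonneg (sub_nonneg.2 (hχ1 x))]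
    exact mul_le_of_le_one_left (norm_nonneg _) (by linarith [hχ0 x])
  · change f x - χ x • f x = 0
    simp [h1 x hx]

theorem ofReal_mul_volume_le_of_dispersive {T : 𝓢(ℝ, ℂ) →L[ℂ] 𝓢(ℝ, ℂ)} {M N : ℝ} (hM : 0 < M)
    (hN : 0 < N) (h2 : ∀ g : 𝓢(ℝ, ℂ), ∫⁻ x, ‖T g x‖ₑ ^ 2 = ∫⁻ x, ‖g x‖ₑ ^ 2)
    (hT : ∀ (g : 𝓢(ℝ, ℂ)) (x : ℝ), ‖T g x‖ₑ ≤ ENNReal.ofReal M * ∫⁻ y, ‖g y‖ₑ) {f : 𝓢(ℝ, ℂ)}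
    (hf : ∫⁻ x, ‖f x‖ₑ ^ (8/7 : ℝ) ≤ ENNReal.ofReal N) {l : ℝ} (hl : 0 < l) :
    ENNReal.ofReal (8 * l ^ 7) * volume {x | ENNReal.ofReal l < ‖T f x‖ₑ} ≤
      ENNReal.ofReal (32 * l ^ 5) *
        ∫⁻ x, {x | l * ‖f x‖ ^ (1/7 : ℝ) ≤ 4 * M * N}.indicator (fun x => ‖f x‖ₑ ^ 2) x := by
  set b : ℝ := 2 * M * N / l with hb
  have hb0 : 0 < b := by positivity
  obtain ⟨g, k, hgk, hgle, hg0, hkle, hk0⟩ := f.exists_add_eq_of_pos (pow_pos hb0 7)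
  have hg : ∫⁻ y, ‖g y‖ₑ ≤ ENNReal.ofReal (b⁻¹ * N) := by
    rw [ENNReal.ofReal_mul (by positivity)]
    refine le_trans ?_ (mul_le_mul_right hf _)
    rw [← lintegral_const_mul' _ _ ENNReal.ofReal_ne_top]
    refine lintegral_mono fun y => ?_
    rcases lt_or_ge ‖f y‖ (b ^ 7) with h | h
    · simp [hg0 y h]
    · have hfy : 0 < ‖f y‖ := (pow_pos hb0 7).trans_le h
      rw [← ofReal_norm, ← ofReal_norm, ENNReal.ofReal_rpow_of_pos hfy,
        ← ENNReal.ofReal_mul (by positivity)]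
      refine ENNReal.ofReal_le_ofReal ((hgle y).trans ?_)
      rw [inv_mul_eq_div, le_div_iff₀ hb0, show (8/7 : ℝ) = 1 + 1/7 by norm_num,
        Real.rpow_add hfy, Real.rpow_one]
      gcongr
      calc b = (b ^ 7) ^ (1/7 : ℝ) := by
            rw [← Real.rpow_natCast, ← Real.rpow_mul hb0.le]; norm_num
        _ ≤ _ := by gcongr
  have hTg : ∀ x, ‖T g x‖ₑ ≤ ENNReal.ofReal (l / 2) := fun x => by
    refine (hT g x).trans ((mul_le_mul_right hg _).trans ?_)
    rw [← ENNReal.ofReal_mul hM.le]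
    refine ENNReal.ofReal_le_ofReal (le_of_eq ?_)
    rw [hb]
    field_simp
  have hsub : {x | ENNReal.ofReal l < ‖T f x‖ₑ} ⊆
      {x | ENNReal.ofReal (l ^ 2 / 4) ≤ ‖T k x‖ₑ ^ 2} := by
    intro x hx
    rw [mem_ofPred_eq] at hx ⊢
    have h1 : ENNReal.ofReal (l / 2) + ENNReal.ofReal (l / 2) ≤
        ‖T k x‖ₑ + ENNReal.ofReal (l / 2) := by
      rw [← ENNReal.ofReal_add (by positivity) (by positivity), add_halves]
      refine hx.le.trans ?_
      rw [← hgk, map_add, add_apply, add_comm ‖T k x‖ₑ]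
      exact (enorm_add_le _ _).trans (add_le_add_left (hTg x) _)
    have h2 := (ENNReal.add_le_add_iff_right ENNReal.ofReal_ne_top).1 h1
    calc ENNReal.ofReal (l ^ 2 / 4) = ENNReal.ofReal (l / 2) ^ 2 := by
          rw [← ENNReal.ofReal_pow (by positivity)]; congr 1; ring
      _ ≤ _ := by gcongr
  have hmarkov := mul_meas_ge_le_lintegral (μ := volume)
    (((T k).continuous.enorm.measurable).pow_const 2) (ENNReal.ofReal (l ^ 2 / 4))
  rw [h2] at hmarkov
  calc ENNReal.ofReal (8 * l ^ 7) * volume {x | ENNReal.ofReal l < ‖T f x‖ₑ}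
      ≤ ENNReal.ofReal (8 * l ^ 7) * volume {x | ENNReal.ofReal (l ^ 2 / 4) ≤ ‖T k x‖ₑ ^ 2} := by
        gcongr
    _ = ENNReal.ofReal (32 * l ^ 5) * (ENNReal.ofReal (l ^ 2 / 4) *
          volume {x | ENNReal.ofReal (l ^ 2 / 4) ≤ ‖T k x‖ₑ ^ 2}) := by
        rw [← mul_assoc, ← ENNReal.ofReal_mul (by positivity)]
        congr 2
        ring
    _ ≤ ENNReal.ofReal (32 * l ^ 5) * ∫⁻ x, ‖k x‖ₑ ^ 2 := by gcongr
    _ ≤ _ := by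
        gcongr with x
        by_cases hx : l * ‖f x‖ ^ (1/7 : ℝ) ≤ 4 * M * N
        · rw [indicator_of_mem (by exact hx), ← ofReal_norm, ← ofReal_norm]
          gcongr
          exact hkle x
        · rw [hk0 x ?_]
          · simp
          have h3 : 2 * b < ‖f x‖ ^ (1/7 : ℝ) := by
            rw [hb, ← mul_div_assoc, div_lt_iff₀ hl]
            linarith
          calc 2 * b ^ 7 ≤ (2 * b) ^ 7 := by
                rw [mul_pow]; gcongr; norm_num
            _ < (‖f x‖ ^ (1/7 : ℝ)) ^ 7 := by gcongr
            _ = ‖f x‖ := by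
                rw [← Real.rpow_natCast, ← Real.rpow_mul (norm_nonneg _)]; norm_num

/-- An operator that is bounded from `L¹` to `L^∞` and isometric on `L²` maps `L^{8/7}` to `L⁸`. -/
theorem lintegral_pow_eight_le_of_dispersive {T : 𝓢(ℝ, ℂ) →L[ℂ] 𝓢(ℝ, ℂ)} {M N : ℝ} (hM : 0 < M)
    (hN : 0 < N) (h2 : ∀ g : 𝓢(ℝ, ℂ), ∫⁻ x, ‖T g x‖ₑ ^ 2 = ∫⁻ x, ‖g x‖ₑ ^ 2)
    (hT : ∀ (g : 𝓢(ℝ, ℂ)) (x : ℝ), ‖T g x‖ₑ ≤ ENNReal.ofReal M * ∫⁻ y, ‖g y‖ₑ) {f : 𝓢(ℝ, ℂ)}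
    (hf : ∫⁻ x, ‖f x‖ₑ ^ (8/7 : ℝ) ≤ ENNReal.ofReal N) :
    ∫⁻ x, ‖T f x‖ₑ ^ 8 ≤ ENNReal.ofReal (32 * 4 ^ 6 * M ^ 6 * N ^ 7) := by
  have hfm : Measurable fun x => ‖f x‖ := f.continuous.norm.measurable
  have hset : MeasurableSet {z : ℝ × ℝ | z.1 * ‖f z.2‖ ^ (1/7 : ℝ) ≤ 4 * M * N} :=
    measurableSet_le (by fun_prop) measurable_const
  have hmeas : Measurable fun z : ℝ × ℝ => ENNReal.ofReal (32 * z.1 ^ 5) *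
      {z : ℝ × ℝ | z.1 * ‖f z.2‖ ^ (1/7 : ℝ) ≤ 4 * M * N}.indicator (fun z => ‖f z.2‖ₑ ^ 2) z := by
    refine Measurable.mul (by fun_prop) (Measurable.indicator ?_ hset)
    exact (f.continuous.enorm.measurable.comp measurable_snd).pow_const 2
  calc ∫⁻ x, ‖T f x‖ₑ ^ 8
      ≤ ∫⁻ l in Ioi (0:ℝ), ENNReal.ofReal (8 * l ^ 7) *
          volume {x | ENNReal.ofReal l < ‖T f x‖ₑ} :=
        lintegral_pow_eight_le (T f).continuous.enorm.measurable
    _ ≤ ∫⁻ l in Ioi (0:ℝ), ∫⁻ x, ENNReal.ofReal (32 * l ^ 5) *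
          {x | l * ‖f x‖ ^ (1/7 : ℝ) ≤ 4 * M * N}.indicator (fun x => ‖f x‖ₑ ^ 2) x := by
        refine setLIntegral_mono' measurableSet_Ioi fun l hl => ?_
        rw [lintegral_const_mul' _ _ ENNReal.ofReal_ne_top]
        exact ofReal_mul_volume_le_of_dispersive hM hN h2 hT hf hl
    _ = ∫⁻ x, ∫⁻ l in Ioi (0:ℝ), ENNReal.ofReal (32 * l ^ 5) *
          {x | l * ‖f x‖ ^ (1/7 : ℝ) ≤ 4 * M * N}.indicator (fun x => ‖f x‖ₑ ^ 2) x :=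
        lintegral_lintegral_swap hmeas.aemeasurable
    _ ≤ ∫⁻ x, ENNReal.ofReal (32 * (4 * M * N) ^ 6) * ‖f x‖ₑ ^ (8/7 : ℝ) := by
        refine lintegral_mono fun x => ?_
        rcases (norm_nonneg (f x)).eq_or_lt with h0 | hpos
        · have hx : f x = 0 := norm_eq_zero.1 h0.symm
          have : ∀ l : ℝ, {x | l * ‖f x‖ ^ (1/7 : ℝ) ≤ 4 * M * N}.indicator
              (fun x => ‖f x‖ₑ ^ 2) x = 0 := fun l => by
            refine indicator_apply_eq_zero.2 fun _ => ?_
            simp [hx]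
          simp only [this, mul_zero, lintegral_zero, zero_le]
        · set B : ℝ := 4 * M * N / ‖f x‖ ^ (1/7 : ℝ) with hB
          have hB0 : 0 < B := by positivity
          calc ∫⁻ l in Ioi (0:ℝ), ENNReal.ofReal (32 * l ^ 5) *
                {x | l * ‖f x‖ ^ (1/7 : ℝ) ≤ 4 * M * N}.indicator (fun x => ‖f x‖ₑ ^ 2) x
              ≤ ∫⁻ l in Ioi (0:ℝ), (Iic B).indicator
                  (fun _ => ENNReal.ofReal (32 * B ^ 5 * ‖f x‖ ^ 2)) l := by
                refine setLIntegral_mono' measurableSet_Ioi fun l hl => ?_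
                have hl' : 0 < l := hl
                by_cases h : l * ‖f x‖ ^ (1/7 : ℝ) ≤ 4 * M * N
                · have hlB : l ≤ B := (le_div_iff₀ (by positivity)).2 h
                  rw [indicator_of_mem (by exact h), indicator_of_mem (by exact hlB),
                    ← ofReal_norm, ← ENNReal.ofReal_pow (norm_nonneg _),
                    ← ENNReal.ofReal_mul (by positivity)]
                  gcongr
                · rw [indicator_of_notMem (by exact h), mul_zero]
                  exact zero_le
            _ = ENNReal.ofReal (32 * B ^ 6 * ‖f x‖ ^ 2) := by
                rw [lintegral_indicator measurableSet_Iic, lintegral_const,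
                  Measure.restrict_restrict measurableSet_Iic, Measure.restrict_apply_univ,
                  Iic_inter_Ioi, Real.volume_Ioc, ← ENNReal.ofReal_mul (by positivity)]
                congr 1
                ring
            _ ≤ _ := by
                rw [← ofReal_norm, ENNReal.ofReal_rpow_of_pos hpos,
                  ← ENNReal.ofReal_mul (by positivity)]
                refine ENNReal.ofReal_le_ofReal (le_of_eq ?_)
                have e : ‖f x‖ ^ 2 = ‖f x‖ ^ (8/7 : ℝ) * (‖f x‖ ^ (1/7 : ℝ)) ^ 6 := by
                  rw [← Real.rpow_natCast, ← Real.rpow_natCast, ← Real.rpow_mul hpos.le,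
                    ← Real.rpow_add hpos]
                  norm_num
                rw [hB, e]
                field_simp
    _ ≤ _ := by
        rw [lintegral_const_mul' _ _ ENNReal.ofReal_ne_top]
        refine (mul_le_mul_right hf _).trans ?_
        rw [← ENNReal.ofReal_mul (by positivity)]
        refine ENNReal.ofReal_le_ofReal (le_of_eq ?_)
        ring

/-- The constant in the `L^{8/7} → L⁸` dispersive estimate. -/
noncomputable def airyConst : ℝ := 40 ^ (3/4 : ℝ) * 32 ^ (1/8 : ℝ)

theorem airyConst_pos : 0 < airyConst := by unfold airyConst; positivity

theorem lintegral_airy_pow_eight_le {a : ℝ} (ha : a ≠ 0) {f : 𝓢(ℝ, ℂ)} {N : ℝ} (hN : 0 < N)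
    (hf : ∫⁻ x, ‖f x‖ₑ ^ (8/7 : ℝ) ≤ ENNReal.ofReal N) :
    ∫⁻ x, ‖airy a f x‖ₑ ^ 8 ≤
      ENNReal.ofReal ((airyConst * |a| ^ (-(1/4) : ℝ) * N ^ (7/8 : ℝ)) ^ 8) := by
  have ha' : 0 < |a| := abs_pos.2 ha
  refine (lintegral_pow_eight_le_of_dispersive (by positivity) hN (lintegral_airy_sq a)
    (enorm_airy_le ha) hf).trans (ENNReal.ofReal_le_ofReal (le_of_eq ?_))
  rw [airyConst]
  simp only [mul_pow, ← Real.rpow_natCast, ← Real.rpow_mul ha'.le, ← Real.rpow_mul hN.le,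
    ← Real.rpow_mul (show (0:ℝ) ≤ 40 by norm_num), ← Real.rpow_mul (show (0:ℝ) ≤ 32 by norm_num)]
  norm_num
  left
  ring

theorem lintegral_airy_pow_eight_le_rpow {a : ℝ} (ha : a ≠ 0) (f : 𝓢(ℝ, ℂ)) :
    ∫⁻ x, ‖airy a f x‖ₑ ^ 8 ≤ (ENNReal.ofReal (airyConst * |a| ^ (-(1/4) : ℝ)) *
      (∫⁻ x, ‖f x‖ₑ ^ (8/7 : ℝ)) ^ (7/8 : ℝ)) ^ 8 := by
  have ha' : 0 < |a| := abs_pos.2 ha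
  have hC := airyConst_pos
  rcases eq_or_ne (∫⁻ x, ‖f x‖ₑ ^ (8/7 : ℝ)) ∞ with h | h
  · rw [h, ENNReal.top_rpow_of_pos (by norm_num), ENNReal.mul_top, ENNReal.top_pow (by norm_num)]
    · exact le_top
    · exact (ENNReal.ofReal_pos.2 (by positivity)).ne'
  rcases eq_or_ne (∫⁻ x, ‖f x‖ₑ ^ (8/7 : ℝ)) 0 with h0 | h0
  · rw [lintegral_eq_zero_iff (f.continuous.enorm.measurable.pow_const _)] at h0
    have : (f : ℝ → ℂ) = 0 := by
      refine (Continuous.ae_eq_iff_eq volume f.continuous continuous_const).1 ?_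
      filter_upwards [h0] with x hx
      exact enorm_eq_zero.1 ((ENNReal.rpow_eq_zero_iff_of_pos (by norm_num)).1 hx)
    have hf0 : f = 0 := DFunLike.coe_injective this
    simp [hf0]
  have hN := ENNReal.toReal_pos h0 h
  refine (lintegral_airy_pow_eight_le ha hN (ENNReal.ofReal_toReal h).ge).trans (le_of_eq ?_)
  rw [ENNReal.ofReal_pow (by positivity), ENNReal.ofReal_mul (by positivity),
    ← ENNReal.ofReal_rpow_of_pos hN, ENNReal.ofReal_toReal h]

/-- The Fourier transform of a Schwartz function on `ℝ × ℝ`, with frequencies in `ℝ × ℝ`. -/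
noncomputable def SchwartzMap.fourierProd (h : 𝓢(ℝ × ℝ, ℂ)) : 𝓢(ℝ × ℝ, ℂ) :=
  SchwartzMap.compCLMOfContinuousLinearEquiv ℂ (WithLp.prodContinuousLinearEquiv 2 ℝ ℝ ℝ).symm
    (𝓕 (SchwartzMap.compCLMOfContinuousLinearEquiv ℂ (WithLp.prodContinuousLinearEquiv 2 ℝ ℝ ℝ) h))

theorem SchwartzMap.fourierProd_apply (h : 𝓢(ℝ × ℝ, ℂ)) (η ζ : ℝ) :
    h.fourierProd (η, ζ) = FT2 h (2 * Real.pi * η) (2 * Real.pi * ζ) := by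
  change (𝓕 (SchwartzMap.compCLMOfContinuousLinearEquiv ℂ
    (WithLp.prodContinuousLinearEquiv 2 ℝ ℝ ℝ) h)) (WithLp.toLp 2 (η, ζ)) = _
  rw [SchwartzMap.fourier_coe, Real.fourier_eq', FT2]
  have := (WithLp.volume_preserving_ofLp ℝ ℝ).integral_comp
    (MeasurableEquiv.toLp 2 (ℝ × ℝ)).symm.measurableEmbedding fun p : ℝ × ℝ =>
      Complex.exp (-(Complex.I * ((p.1 * (2 * Real.pi * η) + p.2 * (2 * Real.pi * ζ) : ℝ) : ℂ))) *
        h p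
  rw [← this]
  refine integral_congr_ae (ae_of_all _ fun p => ?_)
  simp only [smul_eq_mul, SchwartzMap.compCLMOfContinuousLinearEquiv_apply, Function.comp_apply,
    WithLp.prod_inner_apply, WithLp.prodContinuousLinearEquiv_apply, RCLike.inner_apply,
    conj_trivial]
  congr 2
  push_cast
  ring

theorem antilipschitz_prodMk_right (t : ℝ) : AntilipschitzWith 1 fun x : ℝ => (x, t) :=
  AntilipschitzWith.of_le_mul_dist fun x y => by simp [Prod.dist_eq]

theorem hasTemperateGrowth_prodMk_right (t : ℝ) :
    Function.HasTemperateGrowth fun x : ℝ => (x, t) := by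
  have h := (ContinuousLinearMap.inl ℝ ℝ ℝ).hasTemperateGrowth.add
    (Function.HasTemperateGrowth.const ((0, t) : ℝ × ℝ))
  have e : (ContinuousLinearMap.inl ℝ ℝ ℝ : ℝ → ℝ × ℝ) + (fun _ => (0, t)) = fun x => (x, t) := by
    ext <;> simp
  rwa [e] at h

/-- The slice `x ↦ h (x, t)` of a Schwartz function on `ℝ × ℝ`. -/
noncomputable def SchwartzMap.slice (h : 𝓢(ℝ × ℝ, ℂ)) (t : ℝ) : 𝓢(ℝ, ℂ) :=
  SchwartzMap.compCLMOfAntilipschitz ℂ (g := fun x : ℝ => (x, t))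
    (hasTemperateGrowth_prodMk_right t) (antilipschitz_prodMk_right t) h

theorem SchwartzMap.slice_apply (h : 𝓢(ℝ × ℝ, ℂ)) (t x : ℝ) : h.slice t x = h (x, t) := rfl

theorem SchwartzMap.exists_norm_le_inv_one_add_sq (h : 𝓢(ℝ × ℝ, ℂ)) :
    ∃ C : ℝ, ∀ x t : ℝ, ‖h (x, t)‖ ≤ C * (1 + x ^ 2)⁻¹ := by
  obtain ⟨C₀, h₀⟩ := h.decay 0 0
  obtain ⟨C₂, h₂⟩ := h.decay 2 0
  refine ⟨C₀ + C₂, fun x t => ?_⟩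
  rw [← div_eq_mul_inv, le_div_iff₀ (by positivity)]
  have e0 := h₀.2 (x, t)
  have e2 := h₂.2 (x, t)
  rw [norm_iteratedFDeriv_zero] at e0 e2
  have hx : x ^ 2 ≤ ‖(x, t)‖ ^ 2 := by
    rw [← sq_abs x]
    gcongr
    exact norm_fst_le (x, t)
  nlinarith [mul_le_mul_of_nonneg_right hx (norm_nonneg (h (x, t)))]

theorem SchwartzMap.fourier_slice_eq (h : 𝓢(ℝ × ℝ, ℂ)) (t η : ℝ) :
    𝓕 (h.slice t : ℝ → ℂ) η =
      ∫ x : ℝ, Complex.exp (-(Complex.I * (2 * Real.pi * η * x : ℝ))) * h (x, t) := by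
  rw [Real.fourier_real_eq_integral_exp_smul]
  refine integral_congr_ae (ae_of_all _ fun x => ?_)
  simp only [smul_eq_mul, SchwartzMap.slice_apply]
  congr 2
  push_cast
  ring

theorem norm_cexp_neg_I_mul (x : ℝ) : ‖Complex.exp (-(Complex.I * x))‖ = 1 := by
  rw [show -(Complex.I * (x : ℂ)) = ((-x : ℝ) : ℂ) * Complex.I by push_cast; ring]
  exact Complex.norm_exp_ofReal_mul_I _

theorem norm_cexp_I_mul (x : ℝ) : ‖Complex.exp (Complex.I * x)‖ = 1 := by
  rw [mul_comm]
  exact Complex.norm_exp_ofReal_mul_I _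

theorem SchwartzMap.continuous_fourier_slice (h : 𝓢(ℝ × ℝ, ℂ)) (η : ℝ) :
    Continuous fun t => 𝓕 (h.slice t : ℝ → ℂ) η := by
  obtain ⟨C, hC⟩ := h.exists_norm_le_inv_one_add_sq
  have hcont := h.continuous
  simp only [SchwartzMap.fourier_slice_eq]
  refine continuous_of_dominated (bound := fun x => C * (1 + x ^ 2)⁻¹) (fun t => ?_)
    (fun t => ae_of_all _ fun x => ?_) (integrable_inv_one_add_sq.const_mul C)
    (ae_of_all _ fun x => by fun_prop)
  · exact Continuous.aestronglyMeasurable (by fun_prop)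
  · rw [norm_mul, norm_cexp_neg_I_mul, one_mul]
    exact hC x t

theorem SchwartzMap.integrable_cexp_mul (h : 𝓢(ℝ × ℝ, ℂ)) {φ : ℝ × ℝ → ℝ} (hφ : Continuous φ) :
    Integrable (fun p => Complex.exp (-(Complex.I * (φ p : ℝ))) * h p) := by
  refine h.integrable.mono ?_ (ae_of_all _ fun p => ?_)
  · have := h.continuous
    exact Continuous.aestronglyMeasurable (by fun_prop)
  · rw [norm_mul, norm_cexp_neg_I_mul, one_mul]

theorem SchwartzMap.fourier_fourier_slice (h : 𝓢(ℝ × ℝ, ℂ)) (η ζ : ℝ) :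
    𝓕 (fun t => 𝓕 (h.slice t : ℝ → ℂ) η) ζ = h.fourierProd (η, ζ) := by
  rw [SchwartzMap.fourierProd_apply, FT2, Measure.volume_eq_prod,
    integral_prod_symm _ (h.integrable_cexp_mul (by fun_prop)),
    Real.fourier_real_eq_integral_exp_smul]
  refine integral_congr_ae (ae_of_all _ fun t => ?_)
  simp only [smul_eq_mul, SchwartzMap.fourier_slice_eq, ← integral_const_mul]
  refine integral_congr_ae (ae_of_all _ fun x => ?_)
  simp only [← mul_assoc, ← Complex.exp_add]
  congr 2
  push_cast
  ring

/-- Fourier inversion in the second variable. -/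
theorem SchwartzMap.integral_cexp_mul_fourierProd (h : 𝓢(ℝ × ℝ, ℂ)) (t η : ℝ) :
    ∫ ζ : ℝ, Complex.exp (Complex.I * (2 * Real.pi * t * ζ : ℝ)) * h.fourierProd (η, ζ) =
      𝓕 (h.slice t : ℝ → ℂ) η := by
  have h_integrable : Integrable fun t => 𝓕 (h.slice t : ℝ → ℂ) η := by
    simp only [SchwartzMap.fourier_slice_eq]
    exact (h.integrable_cexp_mul (φ := fun p => 2 * Real.pi * η * p.1)
      (by fun_prop)).integral_prod_right
  have hF : 𝓕 (fun t => 𝓕 (h.slice t : ℝ → ℂ) η) = fun ζ => h.fourierProd (η, ζ) :=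
    funext fun ζ => h.fourier_fourier_slice η ζ
  have h_integrable' : Integrable (𝓕 fun t => 𝓕 (h.slice t : ℝ → ℂ) η) := by
    rw [hF]
    obtain ⟨C, hC⟩ := (SchwartzMap.compCLMOfContinuousLinearEquiv ℂ
      (ContinuousLinearEquiv.prodComm ℝ ℝ ℝ) h.fourierProd).exists_norm_le_inv_one_add_sq
    have := h.fourierProd.continuous
    refine (integrable_inv_one_add_sq.const_mul C).mono'
      (Continuous.aestronglyMeasurable (by fun_prop)) (ae_of_all _ fun ζ => hC ζ η)
  have hinv := congrFun ((h.continuous_fourier_slice η).fourierInv_fourier_eq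
    h_integrable h_integrable') t
  rw [← hinv, hF, Real.fourierInv_eq']
  refine integral_congr_ae (ae_of_all _ fun ζ => ?_)
  simp only [smul_eq_mul]
  congr 2
  simp
  ring

theorem integral_eq_two_pi_mul (g : ℝ → ℂ) :
    ∫ ξ, g ξ = (2 * Real.pi : ℂ) * ∫ η, g (2 * Real.pi * η) := by
  have hpi : (Real.pi : ℂ) ≠ 0 := by exact_mod_cast Real.pi_ne_zero
  rw [Measure.integral_comp_mul_left g, abs_of_pos (by positivity), Complex.real_smul]
  push_cast
  field_simp

theorem inv_add_mul_I_eq_integral {σ : ℝ} (hσ : σ = 1 ∨ σ = -1) (A : ℝ) :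
    ((A : ℂ) + σ * Complex.I)⁻¹ =
      -(Complex.I * σ) * ∫ s in Ioi (0:ℝ), Complex.exp ((Complex.I * (σ * A) - 1) * s) := by
  have hre : (Complex.I * (σ * A) - 1 : ℂ).re < 0 := by simp
  have hne : (Complex.I * (σ * A) - 1 : ℂ) ≠ 0 := fun h => by simp [h] at hre
  have hσ2 : (σ : ℂ) ^ 2 = 1 := by rcases hσ with rfl | rfl <;> norm_num
  have hd : (A : ℂ) + σ * Complex.I = -(Complex.I * σ) * (Complex.I * (σ * A) - 1) := by
    linear_combination (-(A : ℂ)) * hσ2 + σ ^ 2 * A * Complex.I_sq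
  have hs : (σ : ℂ) ≠ 0 := fun h => by simp [h] at hσ2
  have hI := Complex.I_ne_zero
  rw [integral_exp_mul_complex_Ioi hre, hd, Complex.ofReal_zero, mul_zero, Complex.exp_zero]
  field_simp
  rw [hσ2, Complex.I_sq]
  ring

/-- The symbol `τ - ξ³` at the frequencies `ξ = 2 * π * η`, `τ = 2 * π * ζ`. -/
noncomputable def airySymbol (z : ℝ × ℝ) : ℝ := 2 * Real.pi * z.2 - (2 * Real.pi * z.1) ^ 3

theorem continuous_airySymbol : Continuous airySymbol := by unfold airySymbol; fun_prop

theorem one_le_norm_add_mul_I {σ : ℝ} (hσ : σ = 1 ∨ σ = -1) (A : ℝ) :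
    1 ≤ ‖(A : ℂ) + σ * Complex.I‖ := by
  have h := Complex.abs_im_le_norm ((A : ℂ) + σ * Complex.I)
  have e : |((A : ℂ) + σ * Complex.I).im| = 1 := by rcases hσ with rfl | rfl <;> simp
  rwa [e] at h

theorem Sop_eq_integral_prod (h : 𝓢(ℝ × ℝ, ℂ)) {σ : ℝ} (hσ : σ = 1 ∨ σ = -1) (x t : ℝ) :
    Sop σ (fun p => h p) (x, t) = (2 * Real.pi : ℂ) ^ 2 * ∫ z : ℝ × ℝ,
      Complex.exp (Complex.I * (2 * Real.pi * x * z.1 + 2 * Real.pi * t * z.2 : ℝ)) *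
        (h.fourierProd z * ((airySymbol z : ℂ) + σ * Complex.I)⁻¹) := by
  have hne : ∀ z : ℝ × ℝ, (airySymbol z : ℂ) + σ * Complex.I ≠ 0 := fun z hz => by
    have := one_le_norm_add_mul_I hσ (airySymbol z)
    rw [hz, norm_zero] at this
    linarith
  have h_integrable : Integrable fun z : ℝ × ℝ =>
      Complex.exp (Complex.I * (2 * Real.pi * x * z.1 + 2 * Real.pi * t * z.2 : ℝ)) *
        (h.fourierProd z * ((airySymbol z : ℂ) + σ * Complex.I)⁻¹) := by
    refine h.fourierProd.integrable.mono ?_ (ae_of_all _ fun z => ?_)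
    · have hG := h.fourierProd.continuous
      have hA : Continuous fun z => (airySymbol z : ℂ) + σ * Complex.I :=
        (Complex.continuous_ofReal.comp continuous_airySymbol).add continuous_const
      exact ((Continuous.cexp (by fun_prop)).mul (hG.mul (hA.inv₀ hne))).aestronglyMeasurable
    · rw [norm_mul, norm_cexp_I_mul, one_mul, norm_mul, norm_inv]
      exact mul_le_of_le_one_right (norm_nonneg _)
        (inv_le_one_of_one_le₀ (one_le_norm_add_mul_I hσ _))
  rw [Measure.volume_eq_prod, integral_prod _ h_integrable, Sop, integral_eq_two_pi_mul, sq,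
    mul_assoc (2 * Real.pi : ℂ) (2 * Real.pi : ℂ)]
  congr 1
  rw [← integral_const_mul]
  refine integral_congr_ae (ae_of_all _ fun η => ?_)
  simp only
  rw [integral_eq_two_pi_mul]
  congr 1
  refine integral_congr_ae (ae_of_all _ fun ζ => ?_)
  simp only [SchwartzMap.fourierProd_apply, airySymbol, div_eq_mul_inv]
  push_cast
  congr 2
  ring_nf

theorem airy_slice_apply_eq_integral (h : 𝓢(ℝ × ℝ, ℂ)) (σ x t s : ℝ) :
    ∫ z : ℝ × ℝ, Complex.exp (Complex.I *
        (2 * Real.pi * x * z.1 + 2 * Real.pi * t * z.2 + s * σ * airySymbol z : ℝ)) *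
        h.fourierProd z =
      airy (-(8 * Real.pi ^ 3 * σ * s)) (h.slice (t + σ * s)) x := by
  have h_integrable : Integrable fun z : ℝ × ℝ => Complex.exp (Complex.I *
        (2 * Real.pi * x * z.1 + 2 * Real.pi * t * z.2 + s * σ * airySymbol z : ℝ)) *
        h.fourierProd z := by
    refine h.fourierProd.integrable.mono ?_ (ae_of_all _ fun z => ?_)
    · have := h.fourierProd.continuous
      have := continuous_airySymbol
      exact Continuous.aestronglyMeasurable (by fun_prop)
    · rw [norm_mul, norm_cexp_I_mul, one_mul]
  rw [Measure.volume_eq_prod, integral_prod _ h_integrable, airy_apply_eq_integral]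
  refine integral_congr_ae (ae_of_all _ fun η => ?_)
  simp only
  rw [← SchwartzMap.integral_cexp_mul_fourierProd, ← integral_const_mul]
  refine integral_congr_ae (ae_of_all _ fun ζ => ?_)
  simp only [airySymbol]
  rw [← mul_assoc, ← Complex.exp_add]
  congr 2
  push_cast
  ring

theorem Sop_eq_integral_airy (h : 𝓢(ℝ × ℝ, ℂ)) {σ : ℝ} (hσ : σ = 1 ∨ σ = -1) (x t : ℝ) :
    Sop σ (fun p => h p) (x, t) = (2 * Real.pi : ℂ) ^ 2 * (-(Complex.I * σ) *
      ∫ s in Ioi (0:ℝ), Complex.exp (-s : ℝ) *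
        airy (-(8 * Real.pi ^ 3 * σ * s)) (h.slice (t + σ * s)) x) := by
  have hG := h.fourierProd.continuous
  have hA := continuous_airySymbol
  have h_integrable : Integrable (Function.uncurry fun (z : ℝ × ℝ) (s : ℝ) =>
      Complex.exp (-s : ℝ) * (Complex.exp (Complex.I *
        (2 * Real.pi * x * z.1 + 2 * Real.pi * t * z.2 + s * σ * airySymbol z : ℝ)) *
        h.fourierProd z)) (volume.prod (volume.restrict (Ioi 0))) := by
    have h1 : Integrable (fun s : ℝ => Real.exp (-s)) (volume.restrict (Ioi 0)) :=
      integrableOn_exp_neg_Ioi 0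
    refine (h.fourierProd.integrable.norm.mul_prod h1).mono ?_ (ae_of_all _ fun z => ?_)
    · exact Continuous.aestronglyMeasurable (by fun_prop)
    · simp only [Function.uncurry]
      rw [norm_mul, norm_mul, norm_cexp_I_mul, one_mul, ← Complex.ofReal_exp, Complex.norm_real,
        norm_mul, norm_norm, mul_comm]
  rw [Sop_eq_integral_prod h hσ]
  congr 1
  simp only [← airy_slice_apply_eq_integral, ← integral_const_mul (Complex.exp _)]
  rw [← integral_integral_swap h_integrable, ← integral_const_mul]
  refine integral_congr_ae (ae_of_all _ fun z => ?_)
  simp only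
  have hcomm : ∀ a b c d : ℂ, a * (b * (c * d)) = c * (a * b * d) := fun a b c d => by ring
  rw [inv_add_mul_I_eq_integral hσ, hcomm, ← integral_const_mul]
  congr 1
  refine integral_congr_ae (ae_of_all _ fun s => ?_)
  simp only
  rw [mul_right_comm, ← Complex.exp_add, ← mul_assoc (Complex.exp _), ← Complex.exp_add]
  congr 2
  push_cast
  ring

/-- Minkowski's integral inequality in `L⁸`, with pointwise majorants of the inner norms. -/
theorem lintegral_pow_eight_lintegral_le {α β : Type*} [MeasurableSpace α] [MeasurableSpace β]
    {μ : Measure α} {ν : Measure β} [SFinite μ] [SFinite ν] {f : α × β → ℝ≥0∞} (hf : Measurable f)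
    {w : α → ℝ≥0∞} (hw : Measurable w) (hwtop : ∀ᵐ s ∂μ, w s ≠ ⊤)
    (hw0 : ∀ᵐ s ∂μ, w s = 0 → ∀ x, f (s, x) = 0)
    (hfw : ∀ᵐ s ∂μ, ∫⁻ x, f (s, x) ^ 8 ∂ν ≤ w s ^ 8) :
    ∫⁻ x, (∫⁻ s, f (s, x) ∂μ) ^ 8 ∂ν ≤ (∫⁻ s, w s ∂μ) ^ 8 := by
  have hholder : ∀ x, (∫⁻ s, f (s, x) ∂μ) ^ 8 ≤
      (∫⁻ s, w s ^ (-7 : ℝ) * f (s, x) ^ 8 ∂μ) * (∫⁻ s, w s ∂μ) ^ 7 := by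
    intro x
    have hfx : Measurable fun s => f (s, x) := hf.comp measurable_prodMk_right
    have h := ENNReal.lintegral_mul_le_Lp_mul_Lq μ
      (show Real.HolderConjugate 8 (8/7) by rw [Real.holderConjugate_iff]; norm_num)
      ((hw.pow_const (-7/8 : ℝ)).mul hfx).aemeasurable (hw.pow_const (7/8 : ℝ)).aemeasurable
    have e : ∫⁻ s, f (s, x) ∂μ =
        ∫⁻ s, (((fun s => w s ^ (-7/8 : ℝ)) * fun s => f (s, x)) * fun s => w s ^ (7/8 : ℝ)) s ∂μ := by
      refine lintegral_congr_ae ?_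
      filter_upwards [hwtop, hw0] with s hs hs0
      simp only [Pi.mul_apply]
      rcases eq_or_ne (w s) 0 with h0 | h0
      · simp [hs0 h0 x]
      · rw [mul_right_comm, ← ENNReal.rpow_add _ _ h0 hs]
        norm_num
    rw [← e] at h
    refine (pow_le_pow_left' h 8).trans (le_of_eq ?_)
    rw [mul_pow, ← ENNReal.rpow_natCast, ← ENNReal.rpow_natCast, ← ENNReal.rpow_natCast,
      ← ENNReal.rpow_mul, ← ENNReal.rpow_mul]
    congr 1
    · norm_num
      refine lintegral_congr fun s => ?_
      rw [mul_pow, ← ENNReal.rpow_natCast (w s ^ _), ← ENNReal.rpow_mul]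
      norm_num
    · norm_num
      congr 1
      refine lintegral_congr fun s => ?_
      rw [← ENNReal.rpow_mul]
      norm_num
  have hm : Measurable fun z : α × β => w z.1 ^ (-7 : ℝ) * f z ^ 8 :=
    ((hw.comp measurable_fst).pow_const _).mul (hf.pow_const 8)
  calc ∫⁻ x, (∫⁻ s, f (s, x) ∂μ) ^ 8 ∂ν
      ≤ ∫⁻ x, (∫⁻ s, w s ^ (-7 : ℝ) * f (s, x) ^ 8 ∂μ) * (∫⁻ s, w s ∂μ) ^ 7 ∂ν :=
        lintegral_mono hholder
    _ = (∫⁻ s, ∫⁻ x, w s ^ (-7 : ℝ) * f (s, x) ^ 8 ∂ν ∂μ) * (∫⁻ s, w s ∂μ) ^ 7 := by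
        rw [lintegral_mul_const _ hm.lintegral_prod_left']
        congr 1
        exact (lintegral_lintegral_swap (f := fun s x => w s ^ (-7 : ℝ) * f (s, x) ^ 8)
          hm.aemeasurable).symm
    _ ≤ (∫⁻ s, w s ∂μ) * (∫⁻ s, w s ∂μ) ^ 7 := by
        gcongr ?_ * _
        refine lintegral_mono_ae ?_
        filter_upwards [hwtop, hfw] with s hs hsf
        rw [lintegral_const_mul _ (f := fun x => f (s, x) ^ 8)
          ((hf.comp measurable_prodMk_left).pow_const 8)]
        refine (mul_le_mul_right hsf _).trans ?_
        rcases eq_or_ne (w s) 0 with h0 | h0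
        · simp [h0]
        · rw [← ENNReal.rpow_natCast, ← ENNReal.rpow_add _ _ h0 hs]
          norm_num
    _ = _ := by rw [← pow_succ']

theorem SchwartzMap.stronglyMeasurable_airy_slice (h : 𝓢(ℝ × ℝ, ℂ)) :
    StronglyMeasurable fun q : ℝ × ℝ × ℝ => airy q.1 (h.slice q.2.1) q.2.2 := by
  have hcont := h.continuous
  have h1 : StronglyMeasurable fun r : (ℝ × ℝ × ℝ) × ℝ =>
      ∫ y : ℝ, Complex.exp (-(Complex.I * (2 * Real.pi * r.2 * y : ℝ))) * h (y, r.1.2.1) := by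
    refine StronglyMeasurable.integral_prod_right' (f := fun z : ((ℝ × ℝ × ℝ) × ℝ) × ℝ =>
      Complex.exp (-(Complex.I * (2 * Real.pi * z.1.2 * z.2 : ℝ))) * h (z.2, z.1.1.2.1)) ?_
    exact Continuous.stronglyMeasurable (by fun_prop)
  simp only [airy_apply_eq_integral, SchwartzMap.fourier_slice_eq]
  refine StronglyMeasurable.integral_prod_right' (f := fun r : (ℝ × ℝ × ℝ) × ℝ =>
    Complex.exp (Complex.I * (2 * Real.pi * r.1.2.2 * r.2 + r.1.1 * r.2 ^ 3 : ℝ)) *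
      ∫ y : ℝ, Complex.exp (-(Complex.I * (2 * Real.pi * r.2 * y : ℝ))) * h (y, r.1.2.1)) ?_
  exact (Continuous.stronglyMeasurable (by fun_prop)).mul h1

/-- The `L^{8/7}` norm of the slice of `h` at time `u`. -/
noncomputable def sliceNorm (h : 𝓢(ℝ × ℝ, ℂ)) (u : ℝ) : ℝ≥0∞ :=
  (∫⁻ x, ‖h.slice u x‖ₑ ^ (8/7 : ℝ)) ^ (7/8 : ℝ)

theorem measurable_sliceNorm (h : 𝓢(ℝ × ℝ, ℂ)) : Measurable (sliceNorm h) :=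
  Measurable.pow_const (Measurable.lintegral_prod_left'
    (f := fun z : ℝ × ℝ => ‖h z‖ₑ ^ (8/7 : ℝ)) (h.continuous.enorm.measurable.pow_const _)) _

theorem sliceNorm_ne_top (h : 𝓢(ℝ × ℝ, ℂ)) (u : ℝ) : sliceNorm h u ≠ ⊤ := by
  refine ENNReal.rpow_ne_top_of_nonneg (by norm_num) ?_
  have := lintegral_rpow_enorm_lt_top_of_eLpNorm_lt_top (f := h.slice u) (μ := volume)
    (p := ENNReal.ofReal (8/7)) (ENNReal.ofReal_pos.2 (by norm_num)).ne' ENNReal.ofReal_ne_top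
    ((h.slice u).memLp _ volume).2
  rw [ENNReal.toReal_ofReal (by norm_num)] at this
  exact this.ne

theorem slice_eq_zero_of_sliceNorm_eq_zero {h : 𝓢(ℝ × ℝ, ℂ)} {u : ℝ} (hu : sliceNorm h u = 0) :
    h.slice u = 0 := by
  rw [sliceNorm, ENNReal.rpow_eq_zero_iff_of_pos (by norm_num),
    lintegral_eq_zero_iff ((h.slice u).continuous.enorm.measurable.pow_const _)] at hu
  refine DFunLike.coe_injective
    ((Continuous.ae_eq_iff_eq volume (h.slice u).continuous continuous_const).1 ?_)
  filter_upwards [hu] with x hx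
  exact enorm_eq_zero.1 ((ENNReal.rpow_eq_zero_iff_of_pos (by norm_num)).1 hx)

theorem enorm_Sop_le (h : 𝓢(ℝ × ℝ, ℂ)) {σ : ℝ} (hσ : σ = 1 ∨ σ = -1) (x t : ℝ) :
    ‖Sop σ (fun p => h p) (x, t)‖ₑ ≤ ENNReal.ofReal ((2 * Real.pi) ^ 2) *
      ∫⁻ s in Ioi (0:ℝ), ‖airy (-(8 * Real.pi ^ 3 * σ * s)) (h.slice (t + σ * s)) x‖ₑ := by
  have hσ1 : ‖-(Complex.I * σ)‖ₑ = 1 := by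
    rw [← ofReal_norm]
    rcases hσ with rfl | rfl <;> simp
  have hpi : ‖(2 * Real.pi : ℂ) ^ 2‖ₑ = ENNReal.ofReal ((2 * Real.pi) ^ 2) := by
    rw [← ofReal_norm]
    simp [abs_of_pos Real.pi_pos]
  rw [Sop_eq_integral_airy h hσ, enorm_mul, enorm_mul, hσ1, one_mul, hpi]
  gcongr
  refine (enorm_integral_le_lintegral_enorm _).trans
    (setLIntegral_mono' measurableSet_Ioi fun s hs => ?_)
  have hs' : (0:ℝ) < s := hs
  rw [enorm_mul]
  refine mul_le_of_le_one_left zero_le ?_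
  rw [← ofReal_norm, ← Complex.ofReal_exp, Complex.norm_real, Real.norm_of_nonneg (by positivity)]
  exact ENNReal.ofReal_le_one.2 (Real.exp_le_one_iff.2 (by linarith))

theorem lintegral_dilated_sliceNorm_le (h : 𝓢(ℝ × ℝ, ℂ)) {σ : ℝ} (hσ : σ = 1 ∨ σ = -1) (t : ℝ) :
    ∫⁻ s in Ioi (0:ℝ), ENNReal.ofReal (airyConst * |-(8 * Real.pi ^ 3 * σ * s)| ^ (-(1/4) : ℝ)) *
        sliceNorm h (t + σ * s) ≤
      ENNReal.ofReal airyConst *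
        ∫⁻ u, ENNReal.ofReal (|u - t| ^ (-(1/4) : ℝ)) * sliceNorm h u := by
  have hσ1 : |σ| = 1 := by rcases hσ with rfl | rfl <;> simp
  have hsub : ∫⁻ s, ENNReal.ofReal (|s| ^ (-(1/4) : ℝ)) * sliceNorm h (t + σ * s) =
      ∫⁻ u, ENNReal.ofReal (|u - t| ^ (-(1/4) : ℝ)) * sliceNorm h u := by
    rw [← lintegral_add_left_eq_self (fun u => ENNReal.ofReal (|u - t| ^ (-(1/4) : ℝ)) *
      sliceNorm h u) t]
    simp only [add_sub_cancel_left]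
    rcases hσ with rfl | rfl
    · simp only [one_mul]
    · rw [← lintegral_neg_eq_self]
      simp
  rw [← hsub, ← lintegral_const_mul' _ _ ENNReal.ofReal_ne_top]
  refine le_trans (setLIntegral_mono' measurableSet_Ioi fun s hs => ?_)
    (setLIntegral_le_lintegral (Ioi 0) _)
  have hs' : (0:ℝ) < s := hs
  rw [← mul_assoc, ← ENNReal.ofReal_mul airyConst_pos.le]
  have hle : |-(8 * Real.pi ^ 3 * σ * s)| ^ (-(1/4) : ℝ) ≤ |s| ^ (-(1/4) : ℝ) := by
    refine Real.rpow_le_rpow_of_nonpos (abs_pos.2 hs'.ne') ?_ (by norm_num)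
    rw [abs_neg, abs_mul, abs_mul, hσ1, mul_one,
      abs_of_pos (show 0 < 8 * Real.pi ^ 3 by positivity)]
    refine le_mul_of_one_le_left (abs_nonneg _) ?_
    have : (1:ℝ) ≤ Real.pi ^ 3 := one_le_pow₀ (by linarith [Real.pi_gt_three])
    linarith
  exact mul_le_mul_left (ENNReal.ofReal_le_ofReal
    (mul_le_mul_of_nonneg_left hle airyConst_pos.le)) _

theorem lintegral_airy_slice_pow_eight_le (h : 𝓢(ℝ × ℝ, ℂ)) {σ : ℝ} (hσ : σ = 1 ∨ σ = -1) (t : ℝ) :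
    ∫⁻ x, (∫⁻ s in Ioi (0:ℝ),
        ‖airy (-(8 * Real.pi ^ 3 * σ * s)) (h.slice (t + σ * s)) x‖ₑ) ^ 8 ≤
      (∫⁻ s in Ioi (0:ℝ), ENNReal.ofReal
        (airyConst * |-(8 * Real.pi ^ 3 * σ * s)| ^ (-(1/4) : ℝ)) *
          sliceNorm h (t + σ * s)) ^ 8 := by
  have hC := airyConst_pos
  have hσ0 : σ ≠ 0 := by rcases hσ with rfl | rfl <;> norm_num
  have hmeas : Measurable fun z : ℝ × ℝ =>
      ‖airy (-(8 * Real.pi ^ 3 * σ * z.1)) (h.slice (t + σ * z.1)) z.2‖ₑ :=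
    (h.stronglyMeasurable_airy_slice.comp_measurable
      (g := fun z : ℝ × ℝ => (-(8 * Real.pi ^ 3 * σ * z.1), t + σ * z.1, z.2))
      (by fun_prop)).measurable.enorm
  have ha : ∀ s ∈ Ioi (0:ℝ), -(8 * Real.pi ^ 3 * σ * s) ≠ 0 := fun s hs => by
    have hs' : (0:ℝ) < s := hs
    have := Real.pi_ne_zero
    simp [hσ0, hs'.ne', this]
  have hsm := measurable_sliceNorm h
  have hbound : ∀ s ∈ Ioi (0:ℝ),
      ∫⁻ x, ‖airy (-(8 * Real.pi ^ 3 * σ * s)) (h.slice (t + σ * s)) x‖ₑ ^ 8 ≤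
        (ENNReal.ofReal (airyConst * |-(8 * Real.pi ^ 3 * σ * s)| ^ (-(1/4) : ℝ)) *
          sliceNorm h (t + σ * s)) ^ 8 := fun s hs =>
    lintegral_airy_pow_eight_le_rpow (ha s hs) (h.slice (t + σ * s))
  refine lintegral_pow_eight_lintegral_le hmeas (by fun_prop)
    (ae_of_all _ fun s => ENNReal.mul_ne_top ENNReal.ofReal_ne_top (sliceNorm_ne_top h _))
    (ae_restrict_of_forall_mem measurableSet_Ioi fun s hs h0 x => ?_)
    (ae_restrict_of_forall_mem measurableSet_Ioi hbound)
  have hpos : 0 < |-(8 * Real.pi ^ 3 * σ * s)| := abs_pos.2 (ha s hs)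
  have h1 : sliceNorm h (t + σ * s) = 0 :=
    (mul_eq_zero.1 h0).resolve_left (ENNReal.ofReal_pos.2 (by positivity)).ne'
  simp [slice_eq_zero_of_sliceNorm_eq_zero h1]

theorem lintegral_Sop_slice_le (h : 𝓢(ℝ × ℝ, ℂ)) {σ : ℝ} (hσ : σ = 1 ∨ σ = -1) (t : ℝ) :
    ∫⁻ x, ‖Sop σ (fun p => h p) (x, t)‖ₑ ^ 8 ≤
      ENNReal.ofReal ((2 * Real.pi) ^ 2 * airyConst) ^ 8 *
        (∫⁻ u, ENNReal.ofReal (|u - t| ^ (-(1/4) : ℝ)) * sliceNorm h u) ^ 8 := by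
  calc ∫⁻ x, ‖Sop σ (fun p => h p) (x, t)‖ₑ ^ 8
      ≤ ∫⁻ x, ENNReal.ofReal ((2 * Real.pi) ^ 2) ^ 8 * (∫⁻ s in Ioi (0:ℝ),
          ‖airy (-(8 * Real.pi ^ 3 * σ * s)) (h.slice (t + σ * s)) x‖ₑ) ^ 8 := by
        refine lintegral_mono fun x => ?_
        rw [← mul_pow]
        exact pow_le_pow_left' (enorm_Sop_le h hσ x t) 8
    _ ≤ ENNReal.ofReal ((2 * Real.pi) ^ 2) ^ 8 * (ENNReal.ofReal airyConst *
          ∫⁻ u, ENNReal.ofReal (|u - t| ^ (-(1/4) : ℝ)) * sliceNorm h u) ^ 8 := by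
        rw [lintegral_const_mul' _ _ (ENNReal.pow_ne_top ENNReal.ofReal_ne_top)]
        exact mul_le_mul_right ((lintegral_airy_slice_pow_eight_le h hσ t).trans
          (pow_le_pow_left' (lintegral_dilated_sliceNorm_le h hσ t) 8)) _
    _ = _ := by
        rw [ENNReal.ofReal_mul (by positivity), ← mul_pow, ← mul_pow, mul_assoc]

theorem lintegral_sliceNorm (h : 𝓢(ℝ × ℝ, ℂ)) :
    ∫⁻ u, sliceNorm h u ^ (8/7 : ℝ) = ∫⁻ p, ‖h p‖ₑ ^ (8/7 : ℝ) := by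
  rw [Measure.volume_eq_prod, lintegral_prod_symm _
    (h.continuous.enorm.measurable.pow_const _).aemeasurable]
  refine lintegral_congr fun u => ?_
  rw [sliceNorm, ← ENNReal.rpow_mul]
  norm_num
  rfl

theorem measurable_Sop (h : 𝓢(ℝ × ℝ, ℂ)) {σ : ℝ} (hσ : σ = 1 ∨ σ = -1) :
    Measurable (Sop σ fun p => h p) := by
  have e : (Sop σ fun p => h p) = fun p => (2 * Real.pi : ℂ) ^ 2 * (-(Complex.I * σ) *
      ∫ s in Ioi (0:ℝ), Complex.exp (-s : ℝ) *
        airy (-(8 * Real.pi ^ 3 * σ * s)) (h.slice (p.2 + σ * s)) p.1) :=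
    funext fun p => Sop_eq_integral_airy h hσ p.1 p.2
  rw [e]
  refine Measurable.const_mul (Measurable.const_mul ?_ _) _
  refine StronglyMeasurable.measurable (StronglyMeasurable.integral_prod_right'
    (f := fun z : (ℝ × ℝ) × ℝ => Complex.exp (-z.2 : ℝ) *
      airy (-(8 * Real.pi ^ 3 * σ * z.2)) (h.slice (z.1.2 + σ * z.2)) z.1.1) ?_)
  refine (Continuous.stronglyMeasurable (by fun_prop)).mul
    (h.stronglyMeasurable_airy_slice.comp_measurable
      (g := fun z : (ℝ × ℝ) × ℝ => (-(8 * Real.pi ^ 3 * σ * z.2), z.1.2 + σ * z.2, z.1.1))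
      (by fun_prop))

theorem lintegral_Sop_pow_eight_le (h : 𝓢(ℝ × ℝ, ℂ)) {σ : ℝ} (hσ : σ = 1 ∨ σ = -1) {r : ℝ}
    (hr : 0 < r) (hhr : (∫⁻ p, ‖h p‖ₑ ^ (8/7 : ℝ)) ^ (7/8 : ℝ) ≤ ENNReal.ofReal r) :
    ∫⁻ p, ‖Sop σ (fun p => h p) p‖ₑ ^ 8 ≤
      ENNReal.ofReal ((2 * Real.pi) ^ 2 * airyConst) ^ 8 * ENNReal.ofReal (hlsConst * r ^ 8) := by
  rw [Measure.volume_eq_prod, lintegral_prod_symm _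
    ((measurable_Sop h hσ).enorm.pow_const 8).aemeasurable]
  refine (lintegral_mono fun t => lintegral_Sop_slice_le h hσ t).trans ?_
  rw [lintegral_const_mul' _ _ (ENNReal.pow_ne_top ENNReal.ofReal_ne_top)]
  gcongr
  refine hardy_littlewood_sobolev (measurable_sliceNorm h) hr ?_
  rwa [lintegral_sliceNorm]

theorem le_mul_of_forall_le_ofReal {A B K : ℝ≥0∞} (hK : K ≠ ⊤)
    (h : ∀ r : ℝ, 0 < r → B ≤ ENNReal.ofReal r → A ≤ K * ENNReal.ofReal r) (hB : B ≠ ⊤) :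
    A ≤ K * B := by
  have hlim : Filter.Tendsto (fun ε : ℝ => K * ENNReal.ofReal (B.toReal + ε))
      (nhdsWithin 0 (Ioi 0)) (nhds (K * B)) := by
    have h1 : Filter.Tendsto (fun ε : ℝ => ENNReal.ofReal (B.toReal + ε)) (nhds 0) (nhds B) := by
      have hc : Continuous fun ε : ℝ => ENNReal.ofReal (B.toReal + ε) :=
        ENNReal.continuous_ofReal.comp (by fun_prop)
      have := hc.tendsto 0
      rwa [add_zero, ENNReal.ofReal_toReal hB] at this
    exact ENNReal.Tendsto.const_mul (h1.mono_left nhdsWithin_le_nhds) (Or.inr hK)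
  refine ge_of_tendsto hlim ?_
  filter_upwards [self_mem_nhdsWithin] with ε hε
  have hε' : (0:ℝ) < ε := hε
  refine h _ (by positivity) ?_
  calc B = ENNReal.ofReal B.toReal := (ENNReal.ofReal_toReal hB).symm
    _ ≤ _ := ENNReal.ofReal_le_ofReal (by linarith)

theorem exists_forall_eLpNorm_Sop_le : ∃ c : ℝ, 0 < c ∧
    ∀ h : 𝓢(ℝ × ℝ, ℂ), ∀ σ : ℝ, (σ = 1 ∨ σ = -1) →
    eLpNorm (Sop σ (fun p => h p)) 8 volume ≤
      ENNReal.ofReal c * eLpNorm (fun p : ℝ × ℝ => h p) (8/7) volume := by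
  have hC := airyConst_pos
  have hlsConst_pos : 0 < hlsConst := by unfold hlsConst; positivity
  refine ⟨(2 * Real.pi) ^ 2 * airyConst * hlsConst ^ (1/8 : ℝ), by positivity, fun h σ hσ => ?_⟩
  have hp : ((8/7 : ℝ≥0∞)).toReal = 8/7 := by simp
  have htop : (8/7 : ℝ≥0∞) ≠ ⊤ :=
    ENNReal.div_ne_top (ENNReal.ofNat_ne_top (n := 8)) (OfNat.ofNat_ne_zero 7)
  refine le_mul_of_forall_le_ofReal ENNReal.ofReal_ne_top (fun r hr hhr => ?_)
    (h.memLp (8/7) volume).2.ne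
  rw [eLpNorm_eq_lintegral_rpow_enorm_toReal (by simp) htop, hp,
    show (1 / (8/7) : ℝ) = 7/8 by norm_num] at hhr
  have hmain := lintegral_Sop_pow_eight_le h hσ hr hhr
  rw [eLpNorm_eq_lintegral_rpow_enorm_toReal (by simp) (by simp),
    show (8 : ℝ≥0∞).toReal = 8 by simp, one_div,
    ENNReal.rpow_inv_le_iff (by norm_num)]
  refine (le_of_eq (lintegral_congr fun p => ?_)).trans (hmain.trans (le_of_eq ?_))
  · exact_mod_cast ENNReal.rpow_natCast _ 8
  · have e8 : ∀ a : ℝ≥0∞, a ^ (8:ℝ) = a ^ 8 := fun a => by exact_mod_cast ENNReal.rpow_natCast a 8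
    rw [e8, ← ENNReal.ofReal_mul (by positivity), ← ENNReal.ofReal_pow (by positivity),
      ← ENNReal.ofReal_mul (by positivity), ← ENNReal.ofReal_pow (by positivity)]
    congr 1
    have : (hlsConst ^ (8⁻¹ : ℝ)) ^ 8 = hlsConst := by
      rw [← Real.rpow_natCast, ← Real.rpow_mul hlsConst_pos.le]
      norm_num
    rw [mul_pow _ r, mul_pow _ (hlsConst ^ (8⁻¹ : ℝ)), this]
    ring

end

theorem stmt11 : ∃ c : ℝ, 0 < c ∧ ∀ h : SchwartzMap (ℝ × ℝ) ℂ, ∀ σ : ℝ, (σ = 1 ∨ σ = -1) →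
    eLpNorm (Sop σ (fun p => h p)) 8 volume ≤
      ENNReal.ofReal c * eLpNorm (fun p : ℝ × ℝ => h p) (8/7) volume :=
  exists_forall_eLpNorm_Sop_le
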